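/- arXiv:1706.05887 — 2 statements merged into one kernel-verified Lean document; each statement's English description precedes it below -/
import Mathlib

section
/- For ξ ∈ F_q((T^{-1})), the following are equivalent: (1) ξ is an A-number; (2) ξ is an A*-number; (3) ξ is algebraic over F_q(T). -/
open Polynomial Filter Set
open scoped Classical

noncomputable section

namespace OotoT

variable (Fq : Type) [Field Fq]

/-- We model the field `F_q((T⁻¹))` of Laurent series in `T⁻¹` as `LaurentSeries Fq`,
whose canonical variable `u` plays the role of `T⁻¹`.  Thus `T` itself is `u⁻¹`. -/
def Tel : LaurentSeries Fq := (HahnSeries.single (1 : ℤ) (1 : Fq))⁻¹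

/-- The canonical ring embedding `F_q[T] → F_q((T⁻¹))`, sending `T ↦ u⁻¹`. -/
def ringHomT : Polynomial Fq →+* LaurentSeries Fq :=
  Polynomial.eval₂RingHom (HahnSeries.C : Fq →+* LaurentSeries Fq) (Tel Fq)

/-- The absolute value on `F_q((T⁻¹))`: `|0| = 0` and `|ξ| = q^{-N}` where
`ξ = Σ_{n ≥ N} a_n T^{-n}` with `a_N ≠ 0`; in our model `N` is the order of `ξ`
as a Hahn series in `u = T⁻¹`. -/
def absL (q : ℕ) (ξ : LaurentSeries Fq) : ℝ :=
  if ξ = 0 then 0 else (q : ℝ) ^ (-ξ.order)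

/-- Evaluation of a polynomial `P(X) ∈ (F_q[T])[X]` at `ξ ∈ F_q((T⁻¹))`. -/
def evalP (ξ : LaurentSeries Fq) (P : Polynomial (Polynomial Fq)) : LaurentSeries Fq :=
  Polynomial.eval₂ (ringHomT Fq) ξ P

/-- The height of `P(X) ∈ (F_q[T])[X]`: the maximum of the absolute values of its
coefficients.  A nonzero `c ∈ F_q[T]` has `|c| = q^{deg c}`, so for `P ≠ 0` the height
is `q` raised to the maximal degree of a (nonzero) coefficient of `P`. -/
def heightP (q : ℕ) (P : Polynomial (Polynomial Fq)) : ℝ :=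
  if P = 0 then 0 else (q : ℝ) ^ (P.support.sup fun i => (P.coeff i).natDegree)

/-- `w_n(ξ)`: the supremum (in the extended reals) of the real numbers `w` such that
`0 < |P(ξ)| ≤ H(P)^{-w}` for infinitely many `P(X) ∈ (F_q[T])[X]` of degree at most `n`. -/
def wn (q : ℕ) (n : ℕ) (ξ : LaurentSeries Fq) : EReal :=
  sSup ((fun w : ℝ => (w : EReal)) ''
    {w : ℝ | {P : Polynomial (Polynomial Fq) | P.natDegree ≤ n ∧
      0 < absL Fq q (evalP Fq ξ P) ∧
      absL Fq q (evalP Fq ξ P) ≤ heightP Fq q P ^ (-w)}.Infinite})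

/-- `w(ξ) = limsup_{n→∞} w_n(ξ)/n`. -/
def wB (q : ℕ) (ξ : LaurentSeries Fq) : EReal :=
  Filter.limsup (fun n : ℕ => wn Fq q n ξ / (n : EReal)) Filter.atTop

/-- `ξ` is an `A`-number if `w(ξ) = 0`. -/
def IsANumber (q : ℕ) (ξ : LaurentSeries Fq) : Prop := wB Fq q ξ = 0

/-- `ξ` is an `S`-number if `0 < w(ξ) < +∞`. -/
def IsSNumber (q : ℕ) (ξ : LaurentSeries Fq) : Prop := 0 < wB Fq q ξ ∧ wB Fq q ξ < ⊤

/-- `ξ` is a `T`-number if `w(ξ) = +∞` and `w_n(ξ) < +∞` for all `n ≥ 1`. -/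
def IsTNumber (q : ℕ) (ξ : LaurentSeries Fq) : Prop :=
  wB Fq q ξ = ⊤ ∧ ∀ n : ℕ, 1 ≤ n → wn Fq q n ξ < ⊤

/-- `ξ` is a `U`-number if `w(ξ) = +∞` and `w_n(ξ) = +∞` for some `n ≥ 1`. -/
def IsUNumber (q : ℕ) (ξ : LaurentSeries Fq) : Prop :=
  wB Fq q ξ = ⊤ ∧ ∃ n : ℕ, 1 ≤ n ∧ wn Fq q n ξ = ⊤

/-- The type `t(ξ) = limsup_{n→∞} (log w_n(ξ))/(log n)` of a `T`-number (as an
extended real; for a `T`-number each `w_n(ξ)` is a finite real, recovered by `toReal`). -/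
def typeT (q : ℕ) (ξ : LaurentSeries Fq) : EReal :=
  Filter.limsup
    (fun n : ℕ => ((Real.log (wn Fq q n ξ).toReal / Real.log n : ℝ) : EReal)) Filter.atTop

/-! ### The algebraic closure side -/

/-- The algebraic closure of `F_q((T⁻¹))`. -/
abbrev AC := AlgebraicClosure (LaurentSeries Fq)

/-- The canonical embedding of `F_q((T⁻¹))` into its algebraic closure. -/
def iota : LaurentSeries Fq →+* AC Fq := algebraMap _ _

/-- The embedding `F_q[T] → AC`. -/
def ringHomTC : Polynomial Fq →+* AC Fq := (iota Fq).comp (ringHomT Fq)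

/-- Evaluation of `P(X) ∈ (F_q[T])[X]` at an element of the algebraic closure. -/
def evalPC (α : AC Fq) (P : Polynomial (Polynomial Fq)) : AC Fq :=
  Polynomial.eval₂ (ringHomTC Fq) α P

/-- `P ∈ (F_q[T])[X]` is *the* minimal polynomial of `α`: it is non-constant, irreducible,
primitive, its leading coefficient is monic (in `T`), and `P(α) = 0`.  For `α` algebraic
over `F_q(T)` such a polynomial exists and is unique. -/
def IsMinPolyOf (α : AC Fq) (P : Polynomial (Polynomial Fq)) : Prop :=
  0 < P.natDegree ∧ Irreducible P ∧ P.IsPrimitive ∧ P.leadingCoeff.Monic ∧ evalPC Fq α P = 0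

/-- `α` is algebraic over `F_q(T)`. -/
def IsAlgT (α : AC Fq) : Prop := ∃ P, IsMinPolyOf Fq α P

/-- The degree of an algebraic `α`: the degree of its minimal polynomial. -/
def degT (α : AC Fq) : ℕ := if h : IsAlgT Fq α then h.choose.natDegree else 0

/-- The height of an algebraic `α`: the height of its minimal polynomial. -/
def heightT (q : ℕ) (α : AC Fq) : ℝ := if h : IsAlgT Fq α then heightP Fq q h.choose else 0

/-- The unique extension of the absolute value to the algebraic closure of `F_q((T⁻¹))`,
given by the standard formula `|x| = |N_{K(x)/K}(x)|^{1/[K(x):K]}`, i.e.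
`|x| = |c₀|^{1/d}` where `c₀` is the constant coefficient and `d` the degree of the
minimal polynomial of `x` over `K = F_q((T⁻¹))`. -/
def absC (q : ℕ) (x : AC Fq) : ℝ :=
  absL Fq q ((minpoly (LaurentSeries Fq) x).coeff 0) ^
    (((minpoly (LaurentSeries Fq) x).natDegree : ℝ)⁻¹)

/-- `w_n^*(ξ)`: the supremum (in the extended reals) of the real numbers `w` such that
`0 < |ξ - α| ≤ H(α)^{-w-1}` for infinitely many `α` algebraic over `F_q(T)` of degree
at most `n`. -/
def wnStar (q : ℕ) (n : ℕ) (ξ : LaurentSeries Fq) : EReal :=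
  sSup ((fun w : ℝ => (w : EReal)) ''
    {w : ℝ | {α : AC Fq | IsAlgT Fq α ∧ degT Fq α ≤ n ∧
      0 < absC Fq q (iota Fq ξ - α) ∧
      absC Fq q (iota Fq ξ - α) ≤ heightT Fq q α ^ (-w - 1)}.Infinite})

/-- `w^*(ξ) = limsup_{n→∞} w_n^*(ξ)/n`. -/
def wBStar (q : ℕ) (ξ : LaurentSeries Fq) : EReal :=
  Filter.limsup (fun n : ℕ => wnStar Fq q n ξ / (n : EReal)) Filter.atTop

/-- `ξ` is an `A*`-number if `w^*(ξ) = 0`. -/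
def IsAStarNumber (q : ℕ) (ξ : LaurentSeries Fq) : Prop := wBStar Fq q ξ = 0

/-- `ξ` is a `T*`-number if `w^*(ξ) = +∞` and `w_n^*(ξ) < +∞` for all `n ≥ 1`. -/
def IsTStarNumber (q : ℕ) (ξ : LaurentSeries Fq) : Prop :=
  wBStar Fq q ξ = ⊤ ∧ ∀ n : ℕ, 1 ≤ n → wnStar Fq q n ξ < ⊤

/-- The `*`-type `t^*(ξ) = limsup_{n→∞} (log w_n^*(ξ))/(log n)` of a `T*`-number. -/
def typeTStar (q : ℕ) (ξ : LaurentSeries Fq) : EReal :=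
  Filter.limsup
    (fun n : ℕ => ((Real.log (wnStar Fq q n ξ).toReal / Real.log n : ℝ) : EReal)) Filter.atTop

/-! ### The Laurent series `ξ(r, m)` -/

/-- `r_j = r^{m_0 m_1 ⋯ m_j}`. -/
def rr (r : ℕ) (m : ℕ → ℕ) (j : ℕ) : ℕ := r ^ (∏ i ∈ Finset.range (j + 1), m i)

/-- `α_j(r, m) = Σ_{n=1}^∞ T^{-r_j^n}`, i.e. the power series in `u = T⁻¹` whose
`k`-th coefficient is `1` exactly when `k = r_j^n` for some `n ≥ 1`. -/
def alphaJ (r : ℕ) (m : ℕ → ℕ) (j : ℕ) : LaurentSeries Fq :=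
  HahnSeries.ofPowerSeries ℤ Fq (PowerSeries.mk fun k =>
    if ∃ n : ℕ, 1 ≤ n ∧ k = rr r m j ^ n then 1 else 0)

/-- `ξ_a(r, m) = Σ_{j=0}^∞ a_j α_j(r, m)`, described coefficientwise: the coefficient of
`T^{-k}` is the (finite) sum over `j` of `a_j` times the coefficient of `T^{-k}` in
`α_j(r, m)`. -/
def xiA (r : ℕ) (m : ℕ → ℕ) (a : ℕ → ℕ) : LaurentSeries Fq :=
  HahnSeries.ofPowerSeries ℤ Fq (PowerSeries.mk fun k =>
    ∑ᶠ j : ℕ, (a j : Fq) * (if ∃ n : ℕ, 1 ≤ n ∧ k = rr r m j ^ n then 1 else 0))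

/-- `ξ(r, m) = Σ_{j=0}^∞ α_j(r, m)`. -/
def xi (r : ℕ) (m : ℕ → ℕ) : LaurentSeries Fq := xiA Fq r m fun _ => 1

/-! ### Algebraicity and algebraic dependence over `F_q(T)` for Laurent series -/

/-- `ξ ∈ F_q((T⁻¹))` is algebraic over `F_q(T)`. -/
def IsAlgLS (ξ : LaurentSeries Fq) : Prop :=
  ∃ P : Polynomial (Polynomial Fq), P ≠ 0 ∧ evalP Fq ξ P = 0

/-- Evaluation of a two-variable polynomial `F(X, Y) ∈ (F_q[T])[X, Y]` (coded as an
iterated polynomial ring, `T` innermost, then `X`, then `Y`) at `(ξ, η)`. -/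
def evalXY (ξ η : LaurentSeries Fq) (F : Polynomial (Polynomial (Polynomial Fq))) :
    LaurentSeries Fq :=
  Polynomial.eval₂ (Polynomial.eval₂RingHom (ringHomT Fq) ξ) η F

/-- `ξ` and `η` are algebraically dependent over `F_q(T)`. -/
def AlgDep (ξ η : LaurentSeries Fq) : Prop :=
  ∃ F : Polynomial (Polynomial (Polynomial Fq)), F ≠ 0 ∧ evalXY Fq ξ η F = 0

/-- `deg_X` of `F(X, Y) ∈ (F_q[T])[X, Y]` in our encoding. -/
def degX (F : Polynomial (Polynomial (Polynomial Fq))) : ℕ :=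
  F.support.sup fun i => (F.coeff i).natDegree

/-- `F(X, Y) ∈ (F_q[T])[X, Y]` is primitive (in `X` and `Y`): no non-unit of `F_q[T]`
divides all of its coefficients. -/
def IsPrimitiveXY (F : Polynomial (Polynomial (Polynomial Fq))) : Prop :=
  ∀ c : Polynomial Fq, (∀ i j : ℕ, c ∣ ((F.coeff i).coeff j)) → IsUnit c

end OotoT

open OotoT

/-- A complete nonarchimedean nontrivial absolute value extends to every algebraic extension,
by the formula `|x| = |N(x)|^{1/d}`. -/
theorem exists_absoluteValue_extension {K : Type*} [Field K] (v : AbsoluteValue K ℝ)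
    (hna : IsNonarchimedean v) (hnt : ∃ x, 1 < v x)
    (hcomplete : ∀ f : ℕ → K, (∀ ε > 0, ∃ N, ∀ m ≥ N, ∀ n ≥ N, v (f m - f n) < ε) →
      ∃ g, ∀ ε > 0, ∃ N, ∀ n ≥ N, v (f n - g) < ε)
    (L : Type*) [Field L] [Algebra K L] [Algebra.IsAlgebraic K L] :
    ∃ w : AbsoluteValue L ℝ, IsNonarchimedean w ∧ (∀ x : K, w (algebraMap K L x) = v x) ∧
      ∀ x : L, w x =
        v ((minpoly K x).coeff 0) ^ (((minpoly K x).natDegree : ℝ)⁻¹) := by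
  let : NontriviallyNormedField K :=
    { v.toNormedField with non_trivial := hnt }
  have hnorm : ∀ x : K, ‖x‖ = v x := fun _ => rfl
  have : IsUltrametricDist K :=
    IsUltrametricDist.isUltrametricDist_of_isNonarchimedean_norm hna
  have : CompleteSpace K := by
    apply Metric.complete_of_cauchySeq_tendsto
    intro f hf
    rw [Metric.cauchySeq_iff] at hf
    obtain ⟨g, hg⟩ := hcomplete f (by simpa only [dist_eq_norm, hnorm] using hf)
    refine ⟨g, Metric.tendsto_atTop.2 ?_⟩
    simpa only [dist_eq_norm, hnorm] using hg
  refine ⟨⟨⟨spectralNorm K L, ?_⟩, ?_, ?_, ?_⟩, ?_, ?_, ?_⟩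
  · exact fun x y => spectralAlgNorm_mul x y
  · exact fun x => spectralNorm_nonneg x
  · exact fun x => map_eq_zero_iff_eq_zero (spectralAlgNorm K L)
  · exact fun x y => map_add_le_add (spectralAlgNorm K L) x y
  · exact isNonarchimedean_spectralNorm
  · exact fun x => spectralNorm_extends x
  · intro x
    have := spectralNorm.spectralNorm_eq_norm_coeff_zero_rpow K L x
    rw [one_div] at this
    exact this

section LaurentSeries

variable {Fq : Type} [Field Fq] {q : ℕ}

theorem absL_of_ne_zero {x : LaurentSeries Fq} (hx : x ≠ 0) :
    absL Fq q x = (q : ℝ) ^ (-x.order) := if_neg hx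

@[simp]
theorem absL_zero : absL Fq q 0 = 0 := if_pos rfl

theorem absL_nonneg (x : LaurentSeries Fq) : 0 ≤ absL Fq q x := by
  unfold absL
  split_ifs <;> positivity

theorem absL_le_iff (hq : 1 < q) {x : LaurentSeries Fq} {d : ℤ} :
    absL Fq q x ≤ (q : ℝ) ^ (-d) ↔ ∀ k < d, x.coeff k = 0 := by
  have hq' : (1 : ℝ) < q := by exact_mod_cast hq
  by_cases hx : x = 0
  · subst hx
    simp only [absL_zero, HahnSeries.coeff_zero, implies_true, iff_true]
    positivity
  · rw [absL_of_ne_zero hx, zpow_le_zpow_iff_right₀ hq', neg_le_neg_iff,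
      HahnSeries.le_order_iff_forall hx]

theorem absL_add_le_max (hq : 1 < q) (x y : LaurentSeries Fq) :
    absL Fq q (x + y) ≤ max (absL Fq q x) (absL Fq q y) := by
  have key : ∀ d : ℤ, absL Fq q x ≤ (q : ℝ) ^ (-d) → absL Fq q y ≤ (q : ℝ) ^ (-d) →
      absL Fq q (x + y) ≤ (q : ℝ) ^ (-d) := fun d hx hy => by
    rw [absL_le_iff hq] at *
    intro k hk
    rw [HahnSeries.coeff_add, hx k hk, hy k hk, add_zero]
  by_cases hx : x = 0
  · simp [hx]
  by_cases hy : y = 0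
  · simp [hy]
  rcases le_total (absL Fq q x) (absL Fq q y) with h | h
  · rw [max_eq_right h, absL_of_ne_zero hy]
    rw [absL_of_ne_zero hy] at h
    exact key _ h (absL_of_ne_zero hy).le
  · rw [max_eq_left h, absL_of_ne_zero hx]
    rw [absL_of_ne_zero hx] at h
    exact key _ (absL_of_ne_zero hx).le h

theorem absL_complete (hq : 1 < q) (f : ℕ → LaurentSeries Fq)
    (hf : ∀ ε > 0, ∃ N, ∀ m ≥ N, ∀ n ≥ N, absL Fq q (f m - f n) < ε) :
    ∃ g, ∀ ε > 0, ∃ N, ∀ n ≥ N, absL Fq q (f n - g) < ε := by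
  have hq' : (1 : ℝ) < q := by exact_mod_cast hq
  have hstable : ∀ d : ℤ, ∃ N, ∀ m ≥ N, ∀ n ≥ N, ∀ k < d, (f m).coeff k = (f n).coeff k := by
    intro d
    obtain ⟨N, hN⟩ := hf ((q : ℝ) ^ (-d)) (by positivity)
    refine ⟨N, fun m hm n hn k hk => ?_⟩
    have := (absL_le_iff hq).1 (hN m hm n hn).le k hk
    rwa [HahnSeries.coeff_sub, sub_eq_zero] at this
  choose N hN using hstable
  let c : ℤ → Fq := fun k => (f (N (k + 1))).coeff k
  have hc : ∀ d, ∀ n ≥ N d, ∀ k < d, (f n).coeff k = c k := by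
    intro d n hn k hk
    rw [hN d n hn (max n (N (k + 1))) (hn.trans (le_max_left _ _)) k hk]
    exact hN (k + 1) _ (le_max_right _ _) _ le_rfl k (lt_add_one k)
  have hbdd : BddBelow (Function.support c) := by
    refine ⟨min 0 (f (N 0)).order, fun k hk => ?_⟩
    by_contra! hlt
    rw [lt_min_iff] at hlt
    apply hk
    rw [← hc 0 (N 0) le_rfl k hlt.1]
    exact HahnSeries.coeff_eq_zero_of_lt_order hlt.2
  refine ⟨HahnSeries.ofSuppBddBelow c hbdd, fun ε hε => ?_⟩
  obtain ⟨d, hd⟩ := exists_pow_lt_of_lt_one hε (inv_lt_one_of_one_lt₀ hq')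
  refine ⟨N d, fun n hn => lt_of_le_of_lt ?_ hd⟩
  rw [inv_pow, ← zpow_natCast, ← zpow_neg, absL_le_iff hq]
  intro k hk
  rw [HahnSeries.coeff_sub, HahnSeries.coeff_ofSuppBddBelow, hc d n hn k hk, sub_self]

variable (Fq) in
/-- The absolute value `absL` as a bundled absolute value. -/
def absLValue (hq : 1 < q) : AbsoluteValue (LaurentSeries Fq) ℝ where
  toFun := absL Fq q
  map_mul' x y := by
    by_cases hx : x = 0
    · simp [hx]
    by_cases hy : y = 0
    · simp [hy]
    have : (q : ℝ) ≠ 0 := by positivity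
    rw [absL_of_ne_zero hx, absL_of_ne_zero hy, absL_of_ne_zero (mul_ne_zero hx hy),
      HahnSeries.order_mul hx hy, neg_add, zpow_add₀ this]
  nonneg' := absL_nonneg
  eq_zero' x := by
    refine ⟨fun h => ?_, fun h => by simp [h]⟩
    by_contra hx
    rw [absL_of_ne_zero hx] at h
    have : (0 : ℝ) < (q : ℝ) ^ (-x.order) := by positivity
    exact this.ne' h
  add_le' x y := by
    refine le_trans ?_ (max_le_add_of_nonneg (absL_nonneg x) (absL_nonneg y))
    exact absL_add_le_max hq x y

theorem absL_Tel (hq : 1 < q) : absL Fq q (Tel Fq) = q := by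
  have h1 : (HahnSeries.single (1 : ℤ) (1 : Fq)) ≠ 0 := by simp
  have h2 : absLValue Fq hq (HahnSeries.single (1 : ℤ) (1 : Fq)) = (q : ℝ)⁻¹ := by
    change absL Fq q _ = _
    rw [absL_of_ne_zero h1, HahnSeries.order_single one_ne_zero, zpow_neg_one]
  change absLValue Fq hq _ = _
  rw [Tel, map_inv₀, h2, inv_inv]

theorem absL_C {a : Fq} (ha : a ≠ 0) : absL Fq q (HahnSeries.C a) = 1 := by
  rw [absL_of_ne_zero (by simpa using ha), HahnSeries.order_C, neg_zero, zpow_zero]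

/-- `|c| = q ^ deg c` for nonzero `c ∈ F_q[T]`. -/
theorem absL_ringHomT (hq : 1 < q) {c : Polynomial Fq} (hc : c ≠ 0) :
    absL Fq q (ringHomT Fq c) = (q : ℝ) ^ c.natDegree := by
  have hq' : (1 : ℝ) < q := by exact_mod_cast hq
  have hterm : ∀ (i : ℕ) (a : Fq), a ≠ 0 →
      absL Fq q (HahnSeries.C a * Tel Fq ^ i) = (q : ℝ) ^ i := by
    intro i a ha
    change absLValue Fq hq _ = _
    rw [map_mul, map_pow]
    change absL Fq q _ * absL Fq q _ ^ i = _
    rw [absL_C ha, absL_Tel hq, one_mul]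
  induction c using Polynomial.induction_with_natDegree_le (N := c.natDegree) with
  | df => exact le_rfl
  | zero => exact absurd rfl hc
  | C_mul_pow n a ha _ =>
    rw [natDegree_C_mul_X_pow n a ha, ← hterm n a ha]
    simp [ringHomT]
  | add f g hfg _ ihf ihg =>
    have hg : g ≠ 0 := by
      rintro rfl
      simp at hfg
    rw [natDegree_add_eq_right_of_natDegree_lt hfg, ← ihg hg, map_add]
    by_cases hf : f = 0
    · simp [hf]
    have hlt : absLValue Fq hq (ringHomT Fq f) < absLValue Fq hq (ringHomT Fq g) := by
      change absL Fq q _ < absL Fq q _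
      rw [ihf hf, ihg hg]
      exact pow_lt_pow_right₀ hq' hfg
    exact IsNonarchimedean.add_eq_right_of_lt (f := absLValue Fq hq)
      (fun x y => absL_add_le_max hq x y) hlt

/-- `absC` is a nonarchimedean absolute value extending `absL`. -/
theorem exists_absC_absoluteValue (hq : 1 < q) :
    ∃ w : AbsoluteValue (AC Fq) ℝ, IsNonarchimedean w ∧
      (∀ x, w (iota Fq x) = absL Fq q x) ∧ ∀ x, w x = absC Fq q x := by
  refine exists_absoluteValue_extension (absLValue Fq hq) (fun x y => absL_add_le_max hq x y)
    ⟨Tel Fq, ?_⟩ (fun f hf => absL_complete hq f hf) (AC Fq)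
  change 1 < absL Fq q _
  rw [absL_Tel hq]
  exact_mod_cast hq

theorem evalPC_iota (ξ : LaurentSeries Fq) (P : Polynomial (Polynomial Fq)) :
    evalPC Fq (iota Fq ξ) P = iota Fq (evalP Fq ξ P) :=
  (Polynomial.hom_eval₂ P (ringHomT Fq) (iota Fq) ξ).symm

end LaurentSeries

section Approximation

variable {L : Type*} [Field L] {w : AbsoluteValue L ℝ}

theorem gaussNorm_X_sub_C (hna : IsNonarchimedean w) (a : L) :
    (X - C a).gaussNorm w 1 = max 1 (w a) := by
  apply le_antisymm
  · have h := isNonarchimedean_gaussNorm w hna zero_le_one (X : L[X]) (C (-a))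
    rw [C_neg, ← sub_eq_add_neg] at h
    refine h.trans (max_le_max ?_ ?_)
    · rw [← monomial_one_one_eq_X, gaussNorm_monomial]
      simp
    · rw [← C_neg, gaussNorm_C, w.map_neg]
  · apply max_le
    · have h := le_gaussNorm w (X - C a) zero_le_one 1
      rwa [coeff_sub, coeff_X_one, coeff_C_succ, sub_zero, map_one, one_pow, mul_one] at h
    · have h := le_gaussNorm w (X - C a) zero_le_one 0
      rwa [coeff_sub, coeff_X_zero, coeff_C_zero, zero_sub, w.map_neg, pow_zero, mul_one] at h

theorem abv_eval_le (hna : IsNonarchimedean w) (F : L[X]) (x : L) {n : ℕ}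
    (hn : F.natDegree ≤ n) : w (F.eval x) ≤ F.gaussNorm w 1 * max 1 (w x) ^ n := by
  rw [eval_eq_sum_range]
  obtain ⟨i, hi, h⟩ := IsNonarchimedean.finset_image_add_of_nonempty hna
    (fun i => F.coeff i * x ^ i) (Finset.nonempty_range_add_one (n := F.natDegree))
  refine h.trans ?_
  rw [map_mul, map_pow]
  have h1 := le_gaussNorm w F zero_le_one i
  rw [one_pow, mul_one] at h1
  have h2 : w x ^ i ≤ max 1 (w x) ^ n :=
    (pow_le_pow_left₀ (w.nonneg x) (le_max_right _ _) i).trans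
      (pow_le_pow_right₀ (le_max_left _ _) ((Finset.mem_range_succ_iff.1 hi).trans hn))
  exact mul_le_mul h1 h2 (pow_nonneg (w.nonneg x) i) (gaussNorm_nonneg w _ zero_le_one)

theorem abv_sub_le_max_mul_max (hna : IsNonarchimedean w) (x a : L) :
    w (x - a) ≤ max 1 (w x) * max 1 (w a) := by
  have h : w (x - a) ≤ max (w x) (w a) := by
    have := hna x (-a)
    rwa [w.map_neg, ← sub_eq_add_neg] at this
  refine h.trans (max_le ?_ ?_)
  · exact (le_max_right 1 _).trans
      (le_mul_of_one_le_right (zero_le_one.trans (le_max_left _ _)) (le_max_left _ _))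
  · exact (le_max_right 1 _).trans
      (le_mul_of_one_le_left (zero_le_one.trans (le_max_left _ _)) (le_max_left _ _))

/-- Gauss's lemma: an irreducible nonconstant polynomial divides every polynomial with which
it has a common root. -/
theorem dvd_of_common_root {A : Type*} [CommRing A] [IsDomain A] [NormalizedGCDMonoid A]
    {φ : A →+* L} (hφ : Function.Injective φ) {P Q : A[X]}
    (hP : Irreducible P) (hdeg : P.natDegree ≠ 0) {a : L} (hPa : P.eval₂ φ a = 0)
    (hQa : Q.eval₂ φ a = 0) : P ∣ Q := by
  have hprim := hP.isPrimitive hdeg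
  let K := FractionRing A
  let ψ : K →+* L := IsFractionRing.lift hφ
  have hψ : ψ.comp (algebraMap A K) = φ := by
    ext c
    exact IsFractionRing.lift_algebraMap hφ c
  have hirr : Irreducible (P.map (algebraMap A K)) :=
    hprim.irreducible_iff_irreducible_map_fraction_map.1 hP
  have hdvd : P.map (algebraMap A K) ∣ Q.map (algebraMap A K) := by
    by_contra hnd
    obtain ⟨u, v, huv⟩ := (hirr.coprime_iff_not_dvd).2 hnd
    have h := congrArg (eval₂ ψ a) huv
    simp only [eval₂_add, eval₂_mul, eval₂_map, hψ, hPa, hQa, mul_zero, add_zero,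
      eval₂_one] at h
    exact zero_ne_one h
  exact hprim.dvd_of_fraction_map_dvd_fraction_map hdvd

theorem injective_of_one_le_abv {A : Type*} [CommRing A] {φ : A →+* L}
    (hφ : ∀ c ≠ 0, 1 ≤ w (φ c)) : Function.Injective φ := by
  rw [injective_iff_map_eq_zero]
  intro c hc
  by_contra hne
  have := hφ c hne
  rw [hc, map_zero] at this
  exact absurd this (by norm_num)

theorem one_le_abv_leadingCoeff {A : Type*} [CommRing A] {φ : A →+* L}
    (hφ : ∀ c ≠ 0, 1 ≤ w (φ c)) {P : A[X]} (hP : P ≠ 0) :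
    1 ≤ w (P.map φ).leadingCoeff := by
  rw [leadingCoeff_map_of_injective (injective_of_one_le_abv hφ)]
  exact hφ _ (leadingCoeff_ne_zero.2 hP)

variable [IsAlgClosed L]

/-- The Gauss norm is the nonarchimedean Mahler measure. -/
theorem gaussNorm_eq_prod_roots (hna : IsNonarchimedean w) (F : L[X]) :
    F.gaussNorm w 1 = w F.leadingCoeff * (F.roots.map fun a => max 1 (w a)).prod := by
  have hprod : ∀ s : Multiset L, (s.map (X - C ·)).prod.gaussNorm w 1 =
      (s.map fun a => max 1 (w a)).prod := by
    intro s
    induction s using Multiset.induction_on with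
    | empty => simpa using gaussNorm_C w 1 (1 : L)
    | cons a s ih =>
      rw [Multiset.map_cons, Multiset.prod_cons, gaussNorm_mul hna one_pos, ih,
        gaussNorm_X_sub_C hna, Multiset.map_cons, Multiset.prod_cons]
  conv_lhs => rw [(IsAlgClosed.splits F).eq_prod_roots]
  rw [gaussNorm_mul hna one_pos, gaussNorm_C, hprod]

theorem abv_eval_eq_prod_roots (F : L[X]) (x : L) :
    w (F.eval x) = w F.leadingCoeff * (F.roots.map fun a => w (x - a)).prod := by
  rw [(IsAlgClosed.splits F).eval_eq_prod_roots, map_mul, map_multiset_prod, Multiset.map_map]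
  rfl

/-- The value at `x` of a polynomial vanishing at `a` is controlled by the distance to `a`. -/
theorem abv_eval_le_abv_sub_mul (hna : IsNonarchimedean w) {F : L[X]} (hF : F ≠ 0) {a : L}
    (ha : F.eval a = 0) (x : L) {n : ℕ} (hn : F.natDegree ≤ n) :
    w (F.eval x) ≤ w (x - a) * (max 1 (w x) ^ n * F.gaussNorm w 1) := by
  obtain ⟨s, hs⟩ := Multiset.exists_cons_of_mem ((mem_roots hF).2 ha)
  have hcard : s.card ≤ n := by
    have := F.card_roots'
    rw [hs, Multiset.card_cons] at this
    omega
  have hM : (1 : ℝ) ≤ max 1 (w x) := le_max_left _ _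
  have hM0 : (0 : ℝ) ≤ max 1 (w x) := zero_le_one.trans hM
  have hs0 : 0 ≤ (s.map fun a => max 1 (w a)).prod :=
    Multiset.prod_nonneg fun y hy => by
      obtain ⟨z, -, rfl⟩ := Multiset.mem_map.1 hy
      exact zero_le_one.trans (le_max_left _ _)
  have h1 : (s.map fun a => w (x - a)).prod ≤
      max 1 (w x) ^ n * (s.map fun a => max 1 (w a)).prod := by
    calc (s.map fun a => w (x - a)).prod
        ≤ (s.map fun a => max 1 (w x) * max 1 (w a)).prod :=
          Multiset.prod_map_le_prod_map₀ _ _ (fun _ _ => w.nonneg _)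
            fun a _ => abv_sub_le_max_mul_max hna x a
      _ = max 1 (w x) ^ s.card * (s.map fun a => max 1 (w a)).prod := by
          rw [Multiset.prod_map_mul, Multiset.map_const', Multiset.prod_replicate]
      _ ≤ _ := by gcongr
  rw [abv_eval_eq_prod_roots, gaussNorm_eq_prod_roots hna, hs, Multiset.map_cons,
    Multiset.prod_cons, Multiset.map_cons, Multiset.prod_cons]
  have h2 : (1 : ℝ) ≤ max 1 (w a) := le_max_left _ _
  calc w F.leadingCoeff * (w (x - a) * (s.map fun a => w (x - a)).prod)
      ≤ w F.leadingCoeff * (w (x - a) *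
        (max 1 (w x) ^ n * (1 * (s.map fun a => max 1 (w a)).prod))) := by
        rw [one_mul]
        gcongr
    _ ≤ w F.leadingCoeff * (w (x - a) *
        (max 1 (w x) ^ n * (max 1 (w a) * (s.map fun a => max 1 (w a)).prod))) := by
        gcongr
    _ = _ := by ring

section Resultant

variable {A : Type*} [CommRing A] [IsDomain A] [NormalizedGCDMonoid A] {φ : A →+* L}

/-- The resultant of coprime polynomials is a nonzero element of `A`, hence not small. -/
theorem one_le_abv_resultant (hφ : ∀ c ≠ 0, 1 ≤ w (φ c)) {P Q : A[X]} (hP : Irreducible P)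
    (hdeg : P.natDegree ≠ 0) (hPQ : ¬ P ∣ Q) :
    1 ≤ w (P.map φ).leadingCoeff ^ (Q.map φ).natDegree *
      ((P.map φ).roots.map fun a => w ((Q.map φ).eval a)).prod := by
  have hinj := injective_of_one_le_abv hφ
  have hPφ : P.map φ ≠ 0 := (Polynomial.map_ne_zero_iff hinj).2 hP.ne_zero
  have hres := resultant_eq_prod_eval (P.map φ) (Q.map φ) _ le_rfl (IsAlgClosed.splits _)
  have hmap : resultant (P.map φ) (Q.map φ) = φ (resultant P Q (P.map φ).natDegree
      (Q.map φ).natDegree) := resultant_map_map ..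
  have hw : w (φ (resultant P Q (P.map φ).natDegree (Q.map φ).natDegree)) =
      w (P.map φ).leadingCoeff ^ (Q.map φ).natDegree *
      ((P.map φ).roots.map fun a => w ((Q.map φ).eval a)).prod := by
    rw [← hmap, hres, map_mul, map_pow, map_multiset_prod, Multiset.map_map]
    rfl
  rw [← hw]
  refine hφ _ fun h0 => ?_
  rw [h0, map_zero, map_zero] at hw
  rcases mul_eq_zero.1 hw.symm with h | h
  · exact hPφ (leadingCoeff_eq_zero.1 (w.eq_zero.1 (eq_zero_of_pow_eq_zero h)))
  · rw [Multiset.prod_eq_zero_iff] at h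
    obtain ⟨a, ha, ha0⟩ := Multiset.mem_map.1 h
    rw [mem_roots hPφ, IsRoot, eval_map] at ha
    rw [w.eq_zero, eval_map] at ha0
    exact hPQ (dvd_of_common_root hinj hP hdeg ha ha0)

/-- Liouville's inequality. -/
theorem one_le_abv_eval_mul (hna : IsNonarchimedean w) (hφ : ∀ c ≠ 0, 1 ≤ w (φ c))
    {P Q : A[X]} (hQ : Irreducible Q) (hdeg : Q.natDegree ≠ 0) {x : L}
    (hQx : (Q.map φ).eval x = 0) (hPx : (P.map φ).eval x ≠ 0) {n : ℕ}
    (hn : P.natDegree ≤ n) :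
    1 ≤ w ((P.map φ).eval x) * ((P.map φ).gaussNorm w 1 ^ (Q.natDegree - 1) *
      (Q.map φ).gaussNorm w 1 ^ n) := by
  have hinj := injective_of_one_le_abv hφ
  have hQφ : Q.map φ ≠ 0 := (Polynomial.map_ne_zero_iff hinj).2 hQ.ne_zero
  have hP : P ≠ 0 := by
    rintro rfl
    simp at hPx
  have hQP : ¬ Q ∣ P := fun h => hPx (eval_eq_zero_of_dvd_of_eval_eq_zero
    (Polynomial.map_dvd φ h) hQx)
  have hn' : (P.map φ).natDegree ≤ n := natDegree_map_le.trans hn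
  have hres := one_le_abv_resultant hφ hQ hdeg hQP
  obtain ⟨s, hs⟩ := Multiset.exists_cons_of_mem ((mem_roots hQφ).2 hQx)
  have hcard : s.card = Q.natDegree - 1 := by
    have := (IsAlgClosed.splits (Q.map φ)).natDegree_eq_card_roots
    rw [hs, Multiset.card_cons, natDegree_map_eq_of_injective hinj] at this
    omega
  have hG : 0 ≤ (P.map φ).gaussNorm w 1 := gaussNorm_nonneg w _ zero_le_one
  have hlead := one_le_abv_leadingCoeff hφ hQ.ne_zero
  have hs0 : 0 ≤ (s.map fun a => max 1 (w a)).prod :=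
    Multiset.prod_nonneg fun y hy => by
      obtain ⟨z, -, rfl⟩ := Multiset.mem_map.1 hy
      exact zero_le_one.trans (le_max_left _ _)
  have hprod : (s.map fun a => w ((P.map φ).eval a)).prod ≤
      (P.map φ).gaussNorm w 1 ^ (Q.natDegree - 1) * (s.map fun a => max 1 (w a)).prod ^ n := by
    calc (s.map fun a => w ((P.map φ).eval a)).prod
        ≤ (s.map fun a => (P.map φ).gaussNorm w 1 * max 1 (w a) ^ n).prod :=
          Multiset.prod_map_le_prod_map₀ _ _ (fun _ _ => w.nonneg _)
            fun a _ => abv_eval_le hna _ a hn'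
      _ = _ := by
          rw [Multiset.prod_map_mul, Multiset.map_const', Multiset.prod_replicate, hcard,
            Multiset.prod_map_pow]
  rw [gaussNorm_eq_prod_roots hna (Q.map φ), hs, Multiset.map_cons, Multiset.prod_cons]
  rw [hs, Multiset.map_cons, Multiset.prod_cons] at hres
  have hx : (1 : ℝ) ≤ max 1 (w x) := le_max_left _ _
  calc 1 ≤ _ := hres
    _ ≤ w (Q.map φ).leadingCoeff ^ n * (w ((P.map φ).eval x) *
        ((P.map φ).gaussNorm w 1 ^ (Q.natDegree - 1) *
          (1 * (s.map fun a => max 1 (w a)).prod) ^ n)) := by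
        rw [one_mul]
        gcongr
        exact mul_nonneg (w.nonneg _) (Multiset.prod_nonneg fun y hy => by
          obtain ⟨z, -, rfl⟩ := Multiset.mem_map.1 hy
          exact w.nonneg _)
    _ ≤ w (Q.map φ).leadingCoeff ^ n * (w ((P.map φ).eval x) *
        ((P.map φ).gaussNorm w 1 ^ (Q.natDegree - 1) *
          (max 1 (w x) * (s.map fun a => max 1 (w a)).prod) ^ n)) := by
        gcongr
    _ = _ := by ring

end Resultant

end Approximation

section Wirsing

theorem sum_mul_sum_le_mul_sum_min {ι : Type*} {B : ℝ} (s t : Multiset ι) (f : ι → ℝ)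
    (hs : ∀ i ∈ s, 0 ≤ f i ∧ f i ≤ B) (ht : ∀ i ∈ t, 0 ≤ f i ∧ f i ≤ B) :
    (s.map f).sum * (t.map f).sum ≤
      B * (s.map fun i => (t.map fun j => min (f i) (f j)).sum).sum := by
  rw [← Multiset.sum_map_mul_right, ← Multiset.sum_map_mul_left]
  refine Multiset.sum_map_le_sum_map _ _ fun i hi => ?_
  rw [← Multiset.sum_map_mul_left, ← Multiset.sum_map_mul_left]
  refine Multiset.sum_map_le_sum_map _ _ fun j hj => ?_
  obtain ⟨hi0, hiB⟩ := hs i hi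
  obtain ⟨hj0, hjB⟩ := ht j hj
  rcases le_total (f i) (f j) with h | h
  · rw [min_eq_left h]
    nlinarith
  · rw [min_eq_right h]
    nlinarith

theorem log_multiset_prod_map {ι : Type*} (s : Multiset ι) (f : ι → ℝ)
    (h : ∀ i ∈ s, 0 < f i) :
    Real.log (s.map f).prod = (s.map fun i => Real.log (f i)).sum := by
  rw [Real.log_multiset_prod, Multiset.map_map]
  · rfl
  · intro x hx
    obtain ⟨i, hi, rfl⟩ := Multiset.mem_map.1 hx
    exact (h i hi).ne'

variable {L : Type*} [Field L] {w : AbsoluteValue L ℝ}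

/-- The logarithmic proximity of `a` to `x`. -/
def proximity (w : AbsoluteValue L ℝ) (x a : L) : ℝ :=
  Real.log (max 1 (w x)) + Real.log (max 1 (w a)) - Real.log (w (x - a))

theorem proximity_nonneg (hna : IsNonarchimedean w) {x a : L} (hxa : x ≠ a) :
    0 ≤ proximity w x a := by
  have h := Real.log_le_log (w.pos (sub_ne_zero.2 hxa)) (abv_sub_le_max_mul_max hna x a)
  rw [Real.log_mul (by positivity) (by positivity)] at h
  unfold proximity
  linarith

theorem log_abv_sub_le (hna : IsNonarchimedean w) {x a b : L} (hab : a ≠ b) :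
    Real.log (w (a - b)) ≤ Real.log (max 1 (w x)) + Real.log (max 1 (w a)) +
      Real.log (max 1 (w b)) - min (proximity w x a) (proximity w x b) := by
  have h : w (a - b) ≤ max (w (x - a)) (w (x - b)) := by
    have := hna (x - b) (-(x - a))
    rw [w.map_neg, max_comm] at this
    rwa [show x - b + -(x - a) = a - b by ring] at this
  have ha : 0 ≤ Real.log (max 1 (w a)) := Real.log_nonneg (le_max_left _ _)
  have hb : 0 ≤ Real.log (max 1 (w b)) := Real.log_nonneg (le_max_left _ _)
  have hpos := w.pos (sub_ne_zero.2 hab)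
  rcases le_max_iff.1 h with h | h
  · have := Real.log_le_log hpos h
    have h2 := min_le_left (proximity w x a) (proximity w x b)
    unfold proximity at h2 ⊢
    linarith
  · have := Real.log_le_log hpos h
    have h2 := min_le_right (proximity w x a) (proximity w x b)
    unfold proximity at h2 ⊢
    linarith

variable [IsAlgClosed L]

theorem sum_proximity_roots (hna : IsNonarchimedean w) {F : L[X]} {x : L}
    (hx : F.eval x ≠ 0) :
    (F.roots.map (proximity w x)).sum = F.natDegree * Real.log (max 1 (w x)) +
      Real.log (F.gaussNorm w 1) - Real.log (w (F.eval x)) := by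
  have hF : F ≠ 0 := by
    rintro rfl
    simp at hx
  have hne : ∀ a ∈ F.roots, x ≠ a := by
    rintro a ha rfl
    exact hx ((mem_roots hF).1 ha)
  have hlead : w F.leadingCoeff ≠ 0 := w.ne_zero (leadingCoeff_ne_zero.2 hF)
  have hpos : ∀ a ∈ F.roots, 0 < w (x - a) := fun a ha => w.pos (sub_ne_zero.2 (hne a ha))
  have hpos' : ∀ a ∈ F.roots, 0 < max 1 (w a) := fun a _ => by positivity
  have hprod : ∀ g : L → ℝ, (∀ a ∈ F.roots, 0 < g a) → (F.roots.map g).prod ≠ 0 := by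
    intro g hg h0
    obtain ⟨a, ha, h⟩ := Multiset.mem_map.1 (Multiset.prod_eq_zero_iff.1 h0)
    exact (hg a ha).ne' h
  rw [gaussNorm_eq_prod_roots hna, abv_eval_eq_prod_roots,
    Real.log_mul hlead (hprod _ hpos), Real.log_mul hlead (hprod _ hpos'),
    log_multiset_prod_map _ _ hpos, log_multiset_prod_map _ _ hpos']
  unfold proximity
  rw [Multiset.sum_map_sub, Multiset.sum_map_add, Multiset.map_const', Multiset.sum_replicate,
    nsmul_eq_mul, (IsAlgClosed.splits F).natDegree_eq_card_roots]
  ring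

/-- Two polynomials without common roots cannot both have many roots close to `x`. -/
theorem log_abv_resultant_le (hna : IsNonarchimedean w) {F G : L[X]} {x : L}
    (hF : F.eval x ≠ 0) (hG : G.eval x ≠ 0) (hFG : ∀ a, F.eval a = 0 → G.eval a ≠ 0) :
    Real.log (w F.leadingCoeff ^ G.natDegree * (F.roots.map fun a => w (G.eval a)).prod) ≤
      G.natDegree * Real.log (F.gaussNorm w 1) + F.natDegree * Real.log (G.gaussNorm w 1) +
      F.natDegree * G.natDegree * Real.log (max 1 (w x)) -
      (F.roots.map fun a =>
        (G.roots.map fun b => min (proximity w x a) (proximity w x b)).sum).sum := by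
  have hF0 : F ≠ 0 := by
    rintro rfl
    simp at hF
  have hG0 : G ≠ 0 := by
    rintro rfl
    simp at hG
  have hleadF : w F.leadingCoeff ≠ 0 := w.ne_zero (leadingCoeff_ne_zero.2 hF0)
  have hleadG : w G.leadingCoeff ≠ 0 := w.ne_zero (leadingCoeff_ne_zero.2 hG0)
  have hprod : ∀ (s : Multiset L) (g : L → ℝ), (∀ a ∈ s, 0 < g a) → (s.map g).prod ≠ 0 := by
    intro s g hg h0
    obtain ⟨a, ha, h⟩ := Multiset.mem_map.1 (Multiset.prod_eq_zero_iff.1 h0)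
    exact (hg a ha).ne' h
  have hneF : ∀ a ∈ F.roots, x ≠ a := by
    rintro a ha rfl
    exact hF ((mem_roots hF0).1 ha)
  have hneG : ∀ a ∈ G.roots, x ≠ a := by
    rintro a ha rfl
    exact hG ((mem_roots hG0).1 ha)
  have hGa : ∀ a ∈ F.roots, 0 < w (G.eval a) := fun a ha =>
    w.pos (hFG a ((mem_roots hF0).1 ha))
  have hab : ∀ a ∈ F.roots, ∀ b ∈ G.roots, a ≠ b := by
    rintro a ha b hb rfl
    exact hFG a ((mem_roots hF0).1 ha) ((mem_roots hG0).1 hb)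
  have hpos' : ∀ (s : Multiset L), ∀ a ∈ s, 0 < max 1 (w a) := fun s a _ => by positivity
  have hterm : ∀ a ∈ F.roots, Real.log (w (G.eval a)) ≤ Real.log (w G.leadingCoeff) +
      (G.roots.map fun b => Real.log (max 1 (w x)) + Real.log (max 1 (w a)) +
        Real.log (max 1 (w b)) - min (proximity w x a) (proximity w x b)).sum := by
    intro a ha
    have hpos : ∀ b ∈ G.roots, 0 < w (a - b) := fun b hb =>
      w.pos (sub_ne_zero.2 (hab a ha b hb))
    rw [abv_eval_eq_prod_roots, Real.log_mul hleadG (hprod _ _ hpos),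
      log_multiset_prod_map _ _ hpos]
    exact add_le_add_right (Multiset.sum_map_le_sum_map _ _ fun b hb =>
      log_abv_sub_le hna (hab a ha b hb)) _
  rw [Real.log_mul (pow_ne_zero _ hleadF) (hprod _ _ hGa), Real.log_pow,
    log_multiset_prod_map _ _ hGa]
  refine (add_le_add_right (Multiset.sum_map_le_sum_map _ _ hterm) _).trans (le_of_eq ?_)
  rw [gaussNorm_eq_prod_roots hna F, gaussNorm_eq_prod_roots hna G,
    Real.log_mul hleadF (hprod _ _ (hpos' _)), Real.log_mul hleadG (hprod _ _ (hpos' _)),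
    log_multiset_prod_map _ _ (hpos' _), log_multiset_prod_map _ _ (hpos' _),
    (IsAlgClosed.splits F).natDegree_eq_card_roots,
    (IsAlgClosed.splits G).natDegree_eq_card_roots]
  simp only [Multiset.sum_map_sub, Multiset.sum_map_add, Multiset.map_const',
    Multiset.sum_replicate, nsmul_eq_mul, Multiset.sum_map_mul_left]
  ring

theorem max_one_abv_le_gaussNorm {A : Type*} [CommRing A] {φ : A →+* L}
    (hna : IsNonarchimedean w) (hφ : ∀ c ≠ 0, 1 ≤ w (φ c)) {P : A[X]} (hP : P ≠ 0)
    {a : L} (ha : (P.map φ).eval a = 0) :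
    max 1 (w a) ≤ (P.map φ).gaussNorm w 1 := by
  have hPφ := (Polynomial.map_ne_zero_iff (injective_of_one_le_abv hφ)).2 hP
  obtain ⟨s, hs⟩ := Multiset.exists_cons_of_mem ((mem_roots hPφ).2 ha)
  rw [gaussNorm_eq_prod_roots hna, hs, Multiset.map_cons, Multiset.prod_cons]
  have hs1 : 1 ≤ (s.map fun a => max 1 (w a)).prod :=
    Multiset.one_le_prod fun y hy => by
      obtain ⟨z, -, rfl⟩ := Multiset.mem_map.1 hy
      exact le_max_left _ _
  exact (le_mul_of_one_le_right (by positivity) hs1).trans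
    (le_mul_of_one_le_left (by positivity) (one_le_abv_leadingCoeff hφ hP))

variable {A : Type*} [CommRing A] [IsDomain A] [NormalizedGCDMonoid A] {φ : A →+* L}

/-- Wirsing's argument: of two coprime polynomials with small values at `x`, one has a root
close to `x`. -/
theorem exists_root_close (hna : IsNonarchimedean w) (hφ : ∀ c ≠ 0, 1 ≤ w (φ c))
    {P Q : A[X]} (hP : Irreducible P) (hdeg : P.natDegree ≠ 0) (hPQ : ¬ P ∣ Q) {n : ℕ}
    (hPn : P.natDegree ≤ n) (hQn : Q.natDegree ≤ n) {x : L}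
    (hPx : (P.map φ).eval x ≠ 0) (hQx : (Q.map φ).eval x ≠ 0) {h W : ℝ} (hh : 0 < h)
    (hW : 0 < W) (hPh : Real.log ((P.map φ).gaussNorm w 1) ≤ h)
    (hQh : Real.log ((Q.map φ).gaussNorm w 1) ≤ h)
    (hPW : Real.log (w ((P.map φ).eval x)) ≤ -(W * h))
    (hQW : Real.log (w ((Q.map φ).eval x)) ≤ -(W * h))
    (hx : n * Real.log (max 1 (w x)) ≤ h) :
    ∃ a, ((P.map φ).eval a = 0 ∨ (Q.map φ).eval a = 0) ∧
      Real.log (w (x - a)) ≤ -((W ^ 2 / (4 * n) - 2) * h) := by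
  have hinj := injective_of_one_le_abv hφ
  have hQ : Q ≠ 0 := by
    rintro rfl
    simp at hQx
  have hn : (1 : ℝ) ≤ n := by exact_mod_cast (Nat.one_le_iff_ne_zero.2 hdeg).trans hPn
  have hm : 0 ≤ Real.log (max 1 (w x)) := Real.log_nonneg (le_max_left _ _)
  have hPd : ((P.map φ).natDegree : ℝ) ≤ n := by exact_mod_cast natDegree_map_le.trans hPn
  have hQd : ((Q.map φ).natDegree : ℝ) ≤ n := by exact_mod_cast natDegree_map_le.trans hQn
  have hgauss : ∀ R : A[X], R ≠ 0 → 1 ≤ (R.map φ).gaussNorm w 1 := fun R hR => by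
    have := le_gaussNorm w (R.map φ) zero_le_one (R.map φ).natDegree
    rw [one_pow, mul_one] at this
    exact (one_le_abv_leadingCoeff hφ hR).trans this
  have hprox : ∀ R : A[X], (R.map φ).eval x ≠ 0 → Real.log (w ((R.map φ).eval x)) ≤ -(W * h) →
      W * h ≤ ((R.map φ).roots.map (proximity w x)).sum := by
    intro R hRx hRW
    rw [sum_proximity_roots hna hRx]
    have hR : R ≠ 0 := by
      rintro rfl
      simp at hRx
    have := Real.log_nonneg (hgauss R hR)
    have : 0 ≤ ((R.map φ).natDegree : ℝ) * Real.log (max 1 (w x)) := by positivity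
    linarith
  have hroot : ∃ a, ((P.map φ).eval a = 0 ∨ (Q.map φ).eval a = 0) ∧
      W ^ 2 / (4 * n) * h < proximity w x a := by
    by_contra! hcon
    have hne : ∀ R : A[X], (R.map φ).eval x ≠ 0 → ∀ a ∈ (R.map φ).roots, x ≠ a := by
      rintro R hRx a ha rfl
      exact hRx (mem_roots'.1 ha).2
    have h1 := sum_mul_sum_le_mul_sum_min (B := W ^ 2 / (4 * n) * h) (P.map φ).roots
      (Q.map φ).roots (proximity w x)
      (fun a ha => ⟨proximity_nonneg hna (hne P hPx a ha), hcon a (.inl (mem_roots'.1 ha).2)⟩)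
      (fun a ha => ⟨proximity_nonneg hna (hne Q hQx a ha), hcon a (.inr (mem_roots'.1 ha).2)⟩)
    have h2 := log_abv_resultant_le hna hPx hQx fun a ha hb => by
      rw [eval_map] at ha hb
      exact hPQ (dvd_of_common_root hinj hP hdeg ha hb)
    have h3 := Real.log_nonneg (one_le_abv_resultant hφ hP hdeg hPQ)
    set S := ((P.map φ).roots.map fun a =>
        ((Q.map φ).roots.map fun b => min (proximity w x a) (proximity w x b)).sum).sum
    have hS : S ≤ 3 * n * h := by
      have e1 : ((Q.map φ).natDegree : ℝ) * Real.log ((P.map φ).gaussNorm w 1) ≤ n * h := by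
        gcongr
        exact Real.log_nonneg (hgauss P hP.ne_zero)
      have e2 : ((P.map φ).natDegree : ℝ) * Real.log ((Q.map φ).gaussNorm w 1) ≤ n * h := by
        gcongr
        exact Real.log_nonneg (hgauss Q hQ)
      have e3 : ((P.map φ).natDegree : ℝ) * (Q.map φ).natDegree * Real.log (max 1 (w x)) ≤
          n * h := by
        calc _ ≤ (n : ℝ) * n * Real.log (max 1 (w x)) := by gcongr
          _ = n * (n * Real.log (max 1 (w x))) := by ring
          _ ≤ _ := by gcongr
      linarith
    have hWh : 0 < W * h := by positivity
    have h4 : (W * h) * (W * h) ≤ W ^ 2 / (4 * n) * h * (3 * n * h) := by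
      refine (mul_le_mul (hprox P hPx hPW) (hprox Q hQx hQW) hWh.le
        (hWh.le.trans (hprox P hPx hPW))).trans (h1.trans ?_)
      gcongr
    have h5 : W ^ 2 / (4 * n) * h * (3 * n * h) = 3 / 4 * ((W * h) * (W * h)) := by
      field_simp
    have : 0 < (W * h) * (W * h) := by positivity
    linarith
  obtain ⟨a, ha, hlt⟩ := hroot
  refine ⟨a, ha, ?_⟩
  have hbound : ∀ R : A[X], R ≠ 0 → Real.log ((R.map φ).gaussNorm w 1) ≤ h →
      (R.map φ).eval a = 0 → Real.log (max 1 (w a)) ≤ h := fun R hR hRh hRa =>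
    (Real.log_le_log (by positivity) (max_one_abv_le_gaussNorm hna hφ hR hRa)).trans hRh
  have hal : Real.log (max 1 (w a)) ≤ h := by
    rcases ha with ha | ha
    · exact hbound P hP.ne_zero hPh ha
    · exact hbound Q hQ hQh ha
  have hmh : Real.log (max 1 (w x)) ≤ h := (le_mul_of_one_le_left hm hn).trans hx
  unfold proximity at hlt
  linarith

end Wirsing

section Height

variable {Fq : Type} [Field Fq] {q : ℕ}

theorem heightP_zero : heightP Fq q 0 = 0 := if_pos rfl

theorem heightP_of_ne_zero {P : Polynomial (Polynomial Fq)} (hP : P ≠ 0) :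
    heightP Fq q P = (q : ℝ) ^ (P.support.sup fun i => (P.coeff i).natDegree) := if_neg hP

theorem heightP_nonneg (P : Polynomial (Polynomial Fq)) : 0 ≤ heightP Fq q P := by
  unfold heightP
  split_ifs <;> positivity

theorem one_le_heightP (hq : 1 < q) {P : Polynomial (Polynomial Fq)} (hP : P ≠ 0) :
    1 ≤ heightP Fq q P := by
  rw [heightP_of_ne_zero hP]
  exact one_le_pow₀ (by exact_mod_cast hq.le)

theorem heightP_le_pow_iff (hq : 1 < q) {P : Polynomial (Polynomial Fq)} {h : ℕ} :
    heightP Fq q P ≤ (q : ℝ) ^ h ↔ ∀ i, (P.coeff i).natDegree ≤ h := by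
  by_cases hP : P = 0
  · subst hP
    simp [heightP_zero]
  · rw [heightP_of_ne_zero hP, pow_le_pow_iff_right₀ (by exact_mod_cast hq), Finset.sup_le_iff]
    refine ⟨fun H i => ?_, fun H i _ => H i⟩
    by_cases hi : P.coeff i = 0
    · simp [hi]
    · exact H i (mem_support_iff.2 hi)

theorem evalPC_eq_eval_map (α : AC Fq) (P : Polynomial (Polynomial Fq)) :
    evalPC Fq α P = (P.map (ringHomTC Fq)).eval α := (eval_map _ _).symm

variable {w : AbsoluteValue (AC Fq) ℝ}

theorem abv_eval_map_iota (hw : ∀ x, w (iota Fq x) = absL Fq q x) (ξ : LaurentSeries Fq)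
    (P : Polynomial (Polynomial Fq)) :
    w ((P.map (ringHomTC Fq)).eval (iota Fq ξ)) = absL Fq q (evalP Fq ξ P) := by
  rw [← evalPC_eq_eval_map, evalPC_iota, hw]

theorem abv_ringHomTC (hq : 1 < q) (hw : ∀ x, w (iota Fq x) = absL Fq q x)
    {c : Polynomial Fq} (hc : c ≠ 0) : w (ringHomTC Fq c) = (q : ℝ) ^ c.natDegree :=
  (hw _).trans (absL_ringHomT hq hc)

theorem one_le_abv_ringHomTC (hq : 1 < q) (hw : ∀ x, w (iota Fq x) = absL Fq q x) :
    ∀ c ≠ 0, 1 ≤ w (ringHomTC Fq c) := fun c hc => by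
  rw [abv_ringHomTC hq hw hc]
  exact one_le_pow₀ (by exact_mod_cast hq.le)

theorem gaussNorm_map_ringHomTC (hq : 1 < q) (hw : ∀ x, w (iota Fq x) = absL Fq q x)
    (P : Polynomial (Polynomial Fq)) :
    (P.map (ringHomTC Fq)).gaussNorm w 1 = heightP Fq q P := by
  by_cases hP : P = 0
  · subst hP
    simp [heightP_zero]
  have hq' : (1 : ℝ) < q := by exact_mod_cast hq
  rw [heightP_of_ne_zero hP]
  apply le_antisymm
  · obtain ⟨i, hi⟩ := exists_eq_gaussNorm w 1 (P.map (ringHomTC Fq))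
    rw [hi, one_pow, mul_one, coeff_map]
    by_cases h0 : P.coeff i = 0
    · rw [h0, map_zero, map_zero]
      positivity
    · rw [abv_ringHomTC hq hw h0]
      exact pow_le_pow_right₀ hq'.le
        (Finset.le_sup (f := fun i => (P.coeff i).natDegree) (mem_support_iff.2 h0))
  · obtain ⟨i, hi, hsup⟩ := Finset.exists_mem_eq_sup P.support (support_nonempty.2 hP)
      fun i => (P.coeff i).natDegree
    have h := le_gaussNorm w (P.map (ringHomTC Fq)) zero_le_one i
    rw [one_pow, mul_one, coeff_map, abv_ringHomTC hq hw (mem_support_iff.1 hi)] at h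
    rwa [hsup]

theorem heightP_mul (hq : 1 < q) (P Q : Polynomial (Polynomial Fq)) :
    heightP Fq q (P * Q) = heightP Fq q P * heightP Fq q Q := by
  obtain ⟨w, hna, hw, -⟩ := exists_absC_absoluteValue (Fq := Fq) hq
  rw [← gaussNorm_map_ringHomTC hq hw, Polynomial.map_mul, gaussNorm_mul hna one_pos,
    gaussNorm_map_ringHomTC hq hw, gaussNorm_map_ringHomTC hq hw]

theorem heightP_le_of_dvd (hq : 1 < q) {P Q : Polynomial (Polynomial Fq)} (hQ : Q ≠ 0)
    (h : P ∣ Q) : heightP Fq q P ≤ heightP Fq q Q := by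
  obtain ⟨R, rfl⟩ := h
  rw [heightP_mul hq]
  exact le_mul_of_one_le_right (heightP_nonneg P) (one_le_heightP hq (right_ne_zero_of_mul hQ))

theorem absL_evalP_le (hq : 1 < q) (ξ : LaurentSeries Fq) {P : Polynomial (Polynomial Fq)}
    {n : ℕ} (hn : P.natDegree ≤ n) :
    absL Fq q (evalP Fq ξ P) ≤ heightP Fq q P * max 1 (absL Fq q ξ) ^ n := by
  obtain ⟨w, hna, hw, -⟩ := exists_absC_absoluteValue (Fq := Fq) hq
  have h := abv_eval_le hna (P.map (ringHomTC Fq)) (iota Fq ξ) (natDegree_map_le.trans hn)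
  rwa [abv_eval_map_iota hw, gaussNorm_map_ringHomTC hq hw, hw] at h

theorem absL_eq_zero (hq : 1 < q) {x : LaurentSeries Fq} : absL Fq q x = 0 ↔ x = 0 :=
  (absLValue Fq hq).eq_zero

theorem absL_mul (hq : 1 < q) (x y : LaurentSeries Fq) :
    absL Fq q (x * y) = absL Fq q x * absL Fq q y :=
  (absLValue Fq hq).map_mul x y

theorem finite_heightP_le [Finite Fq] (hq : 1 < q) (n : ℕ) (B : ℝ) :
    {P : Polynomial (Polynomial Fq) | P.natDegree ≤ n ∧ heightP Fq q P ≤ B}.Finite := by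
  obtain ⟨h, hh⟩ := pow_unbounded_of_one_lt B (show (1 : ℝ) < q by exact_mod_cast hq)
  refine Set.Finite.of_injOn (f := fun P (i : Fin (n + 1)) (j : Fin (h + 1)) =>
    (P.coeff i).coeff j) (Set.mapsTo_univ _ _) ?_ Set.finite_univ
  rintro P ⟨hPn, hPB⟩ Q ⟨hQn, hQB⟩ hPQ
  have hP := (heightP_le_pow_iff hq).1 (hPB.trans hh.le)
  have hQ := (heightP_le_pow_iff hq).1 (hQB.trans hh.le)
  ext i j
  by_cases hi : i ≤ n
  · by_cases hj : j ≤ h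
    · exact congrFun (congrFun hPQ ⟨i, by omega⟩) ⟨j, by omega⟩
    · rw [coeff_eq_zero_of_natDegree_lt ((hP i).trans_lt (by omega)),
        coeff_eq_zero_of_natDegree_lt ((hQ i).trans_lt (by omega))]
  · rw [coeff_eq_zero_of_natDegree_lt (hPn.trans_lt (by omega)),
      coeff_eq_zero_of_natDegree_lt (hQn.trans_lt (by omega))]

/-- Siegel's lemma: a pigeonhole construction of polynomials with small value at `ξ`. -/
theorem exists_absL_evalP_le [Fintype Fq] (hq : 1 < q) {ξ : LaurentSeries Fq} {D : ℕ}
    (hD : max 1 (absL Fq q ξ) ≤ (q : ℝ) ^ D) (n : ℕ) {h : ℕ} :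
    ∃ P : Polynomial (Polynomial Fq), P ≠ 0 ∧ P.natDegree ≤ n ∧ heightP Fq q P ≤ (q : ℝ) ^ h ∧
      absL Fq q (evalP Fq ξ P) ≤ (q : ℝ) ^ (-((n : ℤ) * h - n * D)) := by
  have hq' : (1 : ℝ) < q := by exact_mod_cast hq
  let Φ : (Fin (n + 1) → Fin (h + 1) → Fq) → Polynomial (Polynomial Fq) := fun v =>
    ∑ i : Fin (n + 1), monomial (i : ℕ) (∑ j : Fin (h + 1), monomial (j : ℕ) (v i j))
  have hΦ : ∀ v (i : Fin (n + 1)) (j : Fin (h + 1)), ((Φ v).coeff i).coeff j = v i j := by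
    intro v i j
    simp [Φ, finsetSum_coeff, coeff_monomial, Fin.val_inj]
  have hdeg : ∀ v, (Φ v).natDegree ≤ n := fun v =>
    natDegree_sum_le_of_forall_le _ _ fun i _ =>
      (natDegree_monomial_le _).trans (Nat.lt_succ_iff.1 i.2)
  have hcoeff : ∀ v i, ((Φ v).coeff i).natDegree ≤ h := by
    intro v i
    simp only [Φ, finsetSum_coeff, coeff_monomial]
    refine natDegree_sum_le_of_forall_le _ _ fun k _ => ?_
    split_ifs
    · exact natDegree_sum_le_of_forall_le _ _ fun j _ =>
        (natDegree_monomial_le _).trans (Nat.lt_succ_iff.1 j.2)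
    · simp
  let Λ : (Fin (n + 1) → Fin (h + 1) → Fq) → Fin ((n + 1) * h) → Fq := fun v k =>
    (evalP Fq ξ (Φ v)).coeff (k - (h + n * D) : ℤ)
  obtain ⟨v, v', hne, heq⟩ := Fintype.exists_ne_map_eq_of_card_lt Λ (by
    simp only [Fintype.card_fun, Fintype.card_fin, ← pow_mul]
    exact Nat.pow_lt_pow_right Fintype.one_lt_card (by nlinarith))
  have hh : heightP Fq q (Φ v - Φ v') ≤ (q : ℝ) ^ h := (heightP_le_pow_iff hq).2 fun i => by
    rw [coeff_sub]
    exact (natDegree_sub_le _ _).trans (max_le (hcoeff v i) (hcoeff v' i))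
  have hd : (Φ v - Φ v').natDegree ≤ n := (natDegree_sub_le _ _).trans (max_le (hdeg v) (hdeg v'))
  refine ⟨Φ v - Φ v', fun h0 => hne ?_, hd, hh, ?_⟩
  · ext i j
    rw [← hΦ v, ← hΦ v', sub_eq_zero.1 h0]
  · have hbig : absL Fq q (evalP Fq ξ (Φ v - Φ v')) ≤ (q : ℝ) ^ (-(-(h + n * D) : ℤ)) := by
      refine (absL_evalP_le hq ξ hd).trans ?_
      rw [neg_neg]
      calc _ ≤ (q : ℝ) ^ h * ((q : ℝ) ^ D) ^ n := by gcongr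
        _ = (q : ℝ) ^ ((h + n * D : ℕ) : ℤ) := by rw [zpow_natCast, ← pow_mul]; ring
        _ = _ := by push_cast; rfl
    rw [absL_le_iff hq] at hbig ⊢
    intro k hk
    by_cases hk' : k < -(h + n * D)
    · exact hbig k hk'
    · obtain ⟨m, hm⟩ := Int.eq_ofNat_of_zero_le (show 0 ≤ k + (h + n * D) by omega)
      have hm' : m < (n + 1) * h := by
        zify
        linarith
      have := congrFun heq ⟨m, hm'⟩
      simp only [Λ] at this
      rw [show ((m : ℤ) - (h + n * D) : ℤ) = k by omega] at this
      rw [show evalP Fq ξ (Φ v - Φ v') = evalP Fq ξ (Φ v) - evalP Fq ξ (Φ v') from eval₂_sub _,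
        HahnSeries.coeff_sub, this, sub_self]

end Height

section Transcendental

variable {Fq : Type} [Field Fq] {q : ℕ}

theorem infinite_of_unbounded {α : Type*} {S : Set α} (f : α → ℝ)
    (h : ∀ B, ∃ x ∈ S, B < f x) : S.Infinite := by
  intro hS
  obtain ⟨M, hM⟩ := (hS.image f).bddAbove
  obtain ⟨x, hx, hlt⟩ := h M
  exact hlt.not_ge (hM ⟨x, hx, rfl⟩)

theorem evalP_mul (ξ : LaurentSeries Fq) (P Q : Polynomial (Polynomial Fq)) :
    evalP Fq ξ (P * Q) = evalP Fq ξ P * evalP Fq ξ Q := eval₂_mul _ _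

theorem one_le_absL_evalP_C (hq : 1 < q) (ξ : LaurentSeries Fq) {c : Polynomial Fq}
    (hc : c ≠ 0) : 1 ≤ absL Fq q (evalP Fq ξ (C c)) := by
  rw [evalP, eval₂_C, absL_ringHomT hq hc]
  exact one_le_pow₀ (by exact_mod_cast hq.le)

/-- A transcendental series has irreducible approximants of arbitrarily large height. -/
theorem exists_irreducible_absL_evalP_le [Fintype Fq] (hq : 1 < q) {ξ : LaurentSeries Fq}
    (hξ : ¬ IsAlgLS Fq ξ) {n : ℕ} (hn : 1 ≤ n) (B : ℝ) :
    ∃ R : Polynomial (Polynomial Fq), Irreducible R ∧ R.natDegree ≠ 0 ∧ R.natDegree ≤ n ∧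
      B < heightP Fq q R ∧
      absL Fq q (evalP Fq ξ R) ≤ heightP Fq q R ^ (-((n : ℝ) / 2)) := by
  by_contra! hcon
  have hq' : (1 : ℝ) < q := by exact_mod_cast hq
  have hne : ∀ P : Polynomial (Polynomial Fq), P ≠ 0 → 0 < absL Fq q (evalP Fq ξ P) :=
    fun P hP => (absL_nonneg _).lt_of_ne' fun h0 => hξ ⟨P, hP, (absL_eq_zero hq).1 h0⟩
  obtain ⟨M, hM⟩ := ((finite_heightP_le (Fq := Fq) hq n B).image
    fun P => (absL Fq q (evalP Fq ξ P))⁻¹).bddAbove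
  set c : ℝ := max 1 M with hc_def
  have hc : 1 ≤ c := le_max_left _ _
  have hconst : ∀ P : Polynomial (Polynomial Fq), P ≠ 0 → P.natDegree = 0 →
      1 ≤ absL Fq q (evalP Fq ξ P) * c ^ P.natDegree * heightP Fq q P ^ ((n : ℝ) / 2) := by
    intro P hP hdeg
    have h1 : 1 ≤ absL Fq q (evalP Fq ξ P) := by
      rw [eq_C_of_natDegree_eq_zero hdeg] at hP ⊢
      exact one_le_absL_evalP_C hq ξ (C_ne_zero.1 hP)
    have h2 : 1 ≤ heightP Fq q P ^ ((n : ℝ) / 2) :=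
      Real.one_le_rpow (one_le_heightP hq hP) (by positivity)
    rw [hdeg, pow_zero, mul_one]
    exact one_le_mul_of_one_le_of_one_le h1 h2
  have key : ∀ P : Polynomial (Polynomial Fq), P ≠ 0 → P.natDegree ≤ n →
      1 ≤ absL Fq q (evalP Fq ξ P) * c ^ P.natDegree * heightP Fq q P ^ ((n : ℝ) / 2) := by
    intro P
    induction P using UniqueFactorizationMonoid.induction_on_prime with
    | h₁ => exact fun h => absurd rfl h
    | h₂ P hu => exact fun h _ => hconst P h (natDegree_eq_zero_of_isUnit hu)
    | h₃ a p ha hp ih =>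
      intro hpa hdeg
      rw [natDegree_mul hp.ne_zero ha] at hdeg ⊢
      have h1 := ih ha (by omega)
      have h2 : 1 ≤ absL Fq q (evalP Fq ξ p) * c ^ p.natDegree *
          heightP Fq q p ^ ((n : ℝ) / 2) := by
        by_cases hp0 : p.natDegree = 0
        · exact hconst p hp.ne_zero hp0
        have hH := one_le_heightP hq hp.ne_zero
        have hH2 : 1 ≤ heightP Fq q p ^ ((n : ℝ) / 2) := Real.one_le_rpow hH (by positivity)
        have hpos := hne p hp.ne_zero
        by_cases hB : heightP Fq q p ≤ B
        · have h3 : (absL Fq q (evalP Fq ξ p))⁻¹ ≤ c ^ p.natDegree :=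
            ((hM ⟨p, ⟨by omega, hB⟩, rfl⟩).trans (le_max_right 1 M)).trans
              (le_self_pow₀ hc hp0)
          have h4 : 1 ≤ absL Fq q (evalP Fq ξ p) * c ^ p.natDegree := by
            rwa [inv_le_iff_one_le_mul₀' hpos] at h3
          exact one_le_mul_of_one_le_of_one_le h4 hH2
        · have h3 := hcon p hp.irreducible hp0 (by omega) (not_le.1 hB)
          rw [Real.rpow_neg (heightP_nonneg _), inv_lt_iff_one_lt_mul₀ (by positivity)] at h3
          calc (1 : ℝ) ≤ 1 * (heightP Fq q p ^ ((n : ℝ) / 2) * absL Fq q (evalP Fq ξ p)) := by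
                linarith
            _ ≤ c ^ p.natDegree * (heightP Fq q p ^ ((n : ℝ) / 2) *
                absL Fq q (evalP Fq ξ p)) := by
                gcongr
                exact one_le_pow₀ hc
            _ = _ := by ring
      rw [evalP_mul, absL_mul hq, heightP_mul hq,
        Real.mul_rpow (heightP_nonneg _) (heightP_nonneg _), pow_add]
      calc (1 : ℝ) ≤ _ := one_le_mul_of_one_le_of_one_le h2 h1
        _ = _ := by ring
  obtain ⟨D, hD⟩ := pow_unbounded_of_one_lt (max 1 (absL Fq q ξ)) hq'
  obtain ⟨m, hm⟩ := pow_unbounded_of_one_lt ((q : ℝ) ^ (n * D) * c ^ n) hq'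
  obtain ⟨P, hP, hPn, hPh, hPξ⟩ := exists_absL_evalP_le hq hD.le n (h := 2 * m)
  have h1 := key P hP hPn
  have h2 : absL Fq q (evalP Fq ξ P) * c ^ P.natDegree * heightP Fq q P ^ ((n : ℝ) / 2) ≤
      (q : ℝ) ^ (-((n : ℤ) * (2 * m : ℕ) - n * D)) * c ^ n *
        ((q : ℝ) ^ (2 * m)) ^ ((n : ℝ) / 2) := by
    gcongr
    · exact Real.rpow_nonneg (heightP_nonneg P) _
    · exact heightP_nonneg P
  have h3 : ((q : ℝ) ^ (2 * m)) ^ ((n : ℝ) / 2) = (q : ℝ) ^ (m * n) := by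
    rw [← Real.rpow_natCast, ← Real.rpow_mul (by positivity), ← Real.rpow_natCast]
    congr 1
    push_cast
    ring
  have h4 : (q : ℝ) ^ (-((n : ℤ) * (2 * m : ℕ) - n * D)) * c ^ n * (q : ℝ) ^ (m * n) =
      (q : ℝ) ^ (n * D) * c ^ n / (q : ℝ) ^ (m * n) := by
    have : (q : ℝ) ^ (-((n : ℤ) * (2 * m : ℕ) - n * D)) =
        (q : ℝ) ^ (n * D) / ((q : ℝ) ^ (m * n) * (q : ℝ) ^ (m * n)) := by
      rw [← pow_add, ← zpow_natCast, ← zpow_natCast, ← zpow_sub₀ (by positivity)]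
      congr 1
      push_cast
      ring
    rw [this]
    field_simp
  rw [h3, h4] at h2
  have h5 := h1.trans h2
  rw [one_le_div (by positivity)] at h5
  have h6 : (q : ℝ) ^ m ≤ (q : ℝ) ^ (m * n) :=
    pow_le_pow_right₀ hq'.le (Nat.le_mul_of_pos_right m hn)
  linarith

theorem half_le_wn [Fintype Fq] (hq : 1 < q) {ξ : LaurentSeries Fq} (hξ : ¬ IsAlgLS Fq ξ)
    {n : ℕ} (hn : 1 ≤ n) : (((n : ℝ) / 2 : ℝ) : EReal) ≤ wn Fq q n ξ := by
  refine le_sSup ⟨(n : ℝ) / 2, infinite_of_unbounded (heightP Fq q) fun B => ?_, rfl⟩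
  obtain ⟨R, hR, -, hRn, hRB, hRξ⟩ := exists_irreducible_absL_evalP_le hq hξ hn B
  exact ⟨R, ⟨hRn, (absL_nonneg _).lt_of_ne' fun h0 =>
    hξ ⟨R, hR.ne_zero, (absL_eq_zero hq).1 h0⟩, hRξ⟩, hRB⟩

theorem ringHomTC_injective : Function.Injective (ringHomTC Fq) := by
  obtain ⟨w, -, hw, -⟩ := exists_absC_absoluteValue (Fq := Fq) one_lt_two
  exact injective_of_one_le_abv (one_le_abv_ringHomTC one_lt_two hw)

theorem evalPC_ne_zero_of_natDegree_eq_zero (α : AC Fq) {P : Polynomial (Polynomial Fq)}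
    (hP : P ≠ 0) (hdeg : P.natDegree = 0) : evalPC Fq α P ≠ 0 := by
  rw [eq_C_of_natDegree_eq_zero hdeg] at hP ⊢
  rw [evalPC, eval₂_C]
  exact (map_ne_zero_iff _ ringHomTC_injective).2 (C_ne_zero.1 hP)

theorem OotoT.IsMinPolyOf.dvd {α : AC Fq} {P Q : Polynomial (Polynomial Fq)}
    (hP : IsMinPolyOf Fq α P) (hQ : evalPC Fq α Q = 0) : P ∣ Q :=
  dvd_of_common_root ringHomTC_injective hP.2.1 hP.1.ne' hP.2.2.2.2 hQ

theorem exists_irreducible_evalPC_eq_zero {α : AC Fq} {P : Polynomial (Polynomial Fq)}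
    (hP : P ≠ 0) (hα : evalPC Fq α P = 0) :
    ∃ R, Irreducible R ∧ R.natDegree ≠ 0 ∧ evalPC Fq α R = 0 := by
  induction P using UniqueFactorizationMonoid.induction_on_prime with
  | h₁ => exact absurd rfl hP
  | h₂ P hu =>
    exact absurd hα (evalPC_ne_zero_of_natDegree_eq_zero α hP (natDegree_eq_zero_of_isUnit hu))
  | h₃ a p ha hp ih =>
    rw [evalPC, eval₂_mul, mul_eq_zero] at hα
    rcases hα with h | h
    · exact ⟨p, hp.irreducible,
        fun h0 => evalPC_ne_zero_of_natDegree_eq_zero α hp.ne_zero h0 h, h⟩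
    · exact ih ha h

theorem isAlgT_of_evalPC_eq_zero {α : AC Fq} {P : Polynomial (Polynomial Fq)}
    (hP : P ≠ 0) (hα : evalPC Fq α P = 0) : IsAlgT Fq α := by
  obtain ⟨R, hR, hdeg, hRα⟩ := exists_irreducible_evalPC_eq_zero hP hα
  have hlc : R.leadingCoeff.leadingCoeff ≠ 0 :=
    leadingCoeff_ne_zero.2 (leadingCoeff_ne_zero.2 hR.ne_zero)
  have hu : IsUnit (C (C (R.leadingCoeff.leadingCoeff)⁻¹) : Polynomial (Polynomial Fq)) :=
    isUnit_C.2 (isUnit_C.2 (inv_ne_zero hlc).isUnit)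
  have hirr : Irreducible (C (C (R.leadingCoeff.leadingCoeff)⁻¹) * R) :=
    (irreducible_isUnit_mul hu).2 hR
  have hdeg' : (C (C (R.leadingCoeff.leadingCoeff)⁻¹) * R).natDegree = R.natDegree := by
    rw [natDegree_mul hu.ne_zero hR.ne_zero, natDegree_C, zero_add]
  refine ⟨C (C (R.leadingCoeff.leadingCoeff)⁻¹) * R, by omega, hirr,
    hirr.isPrimitive (by omega), ?_, ?_⟩
  · rw [Monic, leadingCoeff_mul, leadingCoeff_mul, leadingCoeff_C, leadingCoeff_C,
      inv_mul_cancel₀ hlc]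
  · rw [evalPC, eval₂_mul]
    exact mul_eq_zero_of_right _ hRα

theorem exists_isMinPolyOf {α : AC Fq} (hα : IsAlgT Fq α) :
    ∃ P, IsMinPolyOf Fq α P ∧ degT Fq α = P.natDegree ∧ heightT Fq q α = heightP Fq q P :=
  ⟨hα.choose, hα.choose_spec, dif_pos hα, dif_pos hα⟩

theorem degT_le_and_heightT_le (hq : 1 < q) {α : AC Fq} {P : Polynomial (Polynomial Fq)}
    (hP : P ≠ 0) (hα : evalPC Fq α P = 0) :
    degT Fq α ≤ P.natDegree ∧ heightT Fq q α ≤ heightP Fq q P := by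
  obtain ⟨R, hR, hdeg, hheight⟩ := exists_isMinPolyOf (q := q) (isAlgT_of_evalPC_eq_zero hP hα)
  rw [hdeg, hheight]
  exact ⟨natDegree_le_of_dvd (hR.dvd hα) hP, heightP_le_of_dvd hq hP (hR.dvd hα)⟩

theorem one_le_heightT (hq : 1 < q) {α : AC Fq} (hα : IsAlgT Fq α) : 1 ≤ heightT Fq q α := by
  obtain ⟨R, hR, -, hheight⟩ := exists_isMinPolyOf (q := q) hα
  rw [hheight]
  exact one_le_heightP hq hR.2.1.ne_zero

theorem exists_isAlgT_close [Fintype Fq] (hq : 1 < q) {ξ : LaurentSeries Fq}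
    (hξ : ¬ IsAlgLS Fq ξ) {n : ℕ} (hn : 48 ≤ n) (B : ℝ) :
    ∃ (α : AC Fq) (h : ℝ), B < h ∧ 0 < h ∧ IsAlgT Fq α ∧ degT Fq α ≤ n ∧
      Real.log (heightT Fq q α) ≤ h ∧ 0 < absC Fq q (iota Fq ξ - α) ∧
      Real.log (absC Fq q (iota Fq ξ - α)) ≤ -(((n : ℝ) / 16 - 2) * h) := by
  have hq' : (1 : ℝ) < q := by exact_mod_cast hq
  have hlogq : 0 < Real.log q := Real.log_pos hq'
  have hn' : (48 : ℝ) ≤ n := by exact_mod_cast hn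
  obtain ⟨w, hna, hw, hwC⟩ := exists_absC_absoluteValue (Fq := Fq) hq
  have hφ := one_le_abv_ringHomTC hq hw
  have hne : ∀ P : Polynomial (Polynomial Fq), P ≠ 0 →
      (P.map (ringHomTC Fq)).eval (iota Fq ξ) ≠ 0 := fun P hP h0 => by
    rw [← evalPC_eq_eval_map, evalPC_iota, map_eq_zero] at h0
    exact hξ ⟨P, hP, h0⟩
  obtain ⟨D, hD⟩ := pow_unbounded_of_one_lt (max 1 (absL Fq q ξ)) hq'
  obtain ⟨R, hR, hRdeg, hRn, hRB, hRξ⟩ := exists_irreducible_absL_evalP_le hq hξ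
    (show 1 ≤ n by omega) (max (Real.exp B) ((q : ℝ) ^ (2 * (1 + D) + n * D)))
  obtain ⟨r, hr⟩ : ∃ r : ℕ, heightP Fq q R = (q : ℝ) ^ r := ⟨_, heightP_of_ne_zero hR.ne_zero⟩
  have hrlarge : 2 * (1 + D) + n * D < r := by
    have := (le_max_right _ _).trans_lt hRB
    rwa [hr, pow_lt_pow_iff_right₀ hq'] at this
  have hrlarge' : (2 * (1 + D) + n * D : ℝ) < r := by exact_mod_cast hrlarge
  have hnD : (0 : ℝ) ≤ n * D := by positivity
  have hloghR : Real.log (heightP Fq q R) = r * Real.log q := by rw [hr, Real.log_pow]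
  have hBr : B < r * Real.log q := by
    rw [← hloghR, Real.lt_log_iff_exp_lt (by rw [hr]; positivity)]
    exact (le_max_left _ _).trans_lt hRB
  have hrpos : (0 : ℝ) < r := by
    have : (0 : ℝ) ≤ D := by positivity
    linarith
  obtain ⟨Q, hQ, hQn, hQh, hQξ⟩ := exists_absL_evalP_le hq hD.le n (h := r - 1)
  have hQr : heightP Fq q Q ≤ heightP Fq q R := by
    rw [hr]
    exact hQh.trans (pow_le_pow_right₀ hq'.le (Nat.sub_le r 1))
  have hRQ : ¬ R ∣ Q := fun hdvd => by
    have := (heightP_le_of_dvd hq hQ hdvd).trans hQh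
    rw [hr, pow_le_pow_iff_right₀ hq'] at this
    omega
  have hlogh : ∀ P : Polynomial (Polynomial Fq), P ≠ 0 → heightP Fq q P ≤ heightP Fq q R →
      Real.log (heightP Fq q P) ≤ r * Real.log q := fun P hP hle => by
    rw [← hloghR]
    exact Real.log_le_log (zero_lt_one.trans_le (one_le_heightP hq hP)) hle
  obtain ⟨α, hα, hclose⟩ := exists_root_close hna hφ hR hRdeg hRQ hRn hQn (hne R hR.ne_zero)
    (hne Q hQ) (h := r * Real.log q) (W := n / 2) (by positivity) (by positivity)
    (by rw [gaussNorm_map_ringHomTC hq hw]; exact hlogh R hR.ne_zero le_rfl)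
    (by rw [gaussNorm_map_ringHomTC hq hw]; exact hlogh Q hQ hQr)
    (by
      have hpos := w.pos (hne R hR.ne_zero)
      rw [abv_eval_map_iota hw] at hpos ⊢
      refine (Real.log_le_log hpos hRξ).trans (le_of_eq ?_)
      rw [Real.log_rpow (by rw [hr]; positivity), hloghR]
      ring)
    (by
      have hpos := w.pos (hne Q hQ)
      rw [abv_eval_map_iota hw] at hpos ⊢
      refine (Real.log_le_log hpos hQξ).trans ?_
      rw [Real.log_zpow, Int.cast_neg, neg_mul, neg_le_neg_iff]
      rw [← mul_assoc]
      gcongr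
      push_cast [Nat.cast_sub (show 1 ≤ r by omega)]
      nlinarith)
    (by
      rw [hw]
      have : Real.log (max 1 (absL Fq q ξ)) ≤ D * Real.log q := by
        rw [← Real.log_pow]
        exact Real.log_le_log (by positivity) hD.le
      calc (n : ℝ) * Real.log (max 1 (absL Fq q ξ)) ≤ n * (D * Real.log q) := by gcongr
        _ = (n * D) * Real.log q := by ring
        _ ≤ r * Real.log q := by
          gcongr
          have : (0 : ℝ) ≤ D := by positivity
          linarith)
  have hroot : ∃ P : Polynomial (Polynomial Fq), P ≠ 0 ∧ P.natDegree ≤ n ∧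
      heightP Fq q P ≤ heightP Fq q R ∧ evalPC Fq α P = 0 := by
    rw [← evalPC_eq_eval_map, ← evalPC_eq_eval_map] at hα
    rcases hα with hα | hα
    · exact ⟨R, hR.ne_zero, hRn, le_rfl, hα⟩
    · exact ⟨Q, hQ, hQn, hQr, hα⟩
  obtain ⟨P, hP, hPn, hPR, hPα⟩ := hroot
  have halg := isAlgT_of_evalPC_eq_zero hP hPα
  obtain ⟨hdeg, hheight⟩ := degT_le_and_heightT_le hq hP hPα
  refine ⟨α, r * Real.log q, hBr, by positivity, halg, hdeg.trans hPn, ?_, ?_, ?_⟩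
  · exact (Real.log_le_log (zero_lt_one.trans_le (one_le_heightT hq halg)) hheight).trans
      (hlogh P hP hPR)
  · rw [← hwC]
    refine w.pos (sub_ne_zero.2 ?_)
    rintro rfl
    rw [evalPC_eq_eval_map] at hPα
    exact hne P hP hPα
  · rw [← hwC]
    refine hclose.trans (le_of_eq ?_)
    field_simp
    ring

theorem le_wnStar [Fintype Fq] (hq : 1 < q) {ξ : LaurentSeries Fq} (hξ : ¬ IsAlgLS Fq ξ)
    {n : ℕ} (hn : 48 ≤ n) : (((n : ℝ) / 16 - 3 : ℝ) : EReal) ≤ wnStar Fq q n ξ := by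
  refine le_sSup ⟨(n : ℝ) / 16 - 3, infinite_of_unbounded
    (fun α => -Real.log (absC Fq q (iota Fq ξ - α))) fun B => ?_, rfl⟩
  obtain ⟨α, h, hB, hpos, halg, hdeg, hheight, hne, hclose⟩ := exists_isAlgT_close hq hξ hn B
  have hn' : (48 : ℝ) ≤ n := by exact_mod_cast hn
  have hH := one_le_heightT hq halg
  refine ⟨α, ⟨halg, hdeg, hne, ?_⟩, ?_⟩
  · have hH0 : 0 < heightT Fq q α := zero_lt_one.trans_le hH
    rw [← Real.log_le_log_iff hne (by positivity), Real.log_rpow hH0]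
    refine hclose.trans ?_
    nlinarith
  · nlinarith

end Transcendental

section Algebraic

variable {Fq : Type} [Field Fq] {q : ℕ}

theorem heightP_C (hq : 1 < q) (ξ : LaurentSeries Fq) (c : Polynomial Fq) :
    heightP Fq q (C c) = absL Fq q (evalP Fq ξ (C c)) := by
  obtain ⟨w, hna, hw, -⟩ := exists_absC_absoluteValue (Fq := Fq) hq
  rw [← gaussNorm_map_ringHomTC hq hw, Polynomial.map_C, gaussNorm_C, ← hw, evalP, eval₂_C]
  rfl

theorem neg_one_le_wn (hq : 1 < q) (ξ : LaurentSeries Fq) (n : ℕ) :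
    ((-1 : ℝ) : EReal) ≤ wn Fq q n ξ := by
  have hq' : (1 : ℝ) < q := by exact_mod_cast hq
  refine le_sSup ⟨-1, infinite_of_unbounded (heightP Fq q) fun B => ?_, rfl⟩
  obtain ⟨k, hk⟩ := pow_unbounded_of_one_lt B hq'
  have hX : (X ^ k : Polynomial Fq) ≠ 0 := pow_ne_zero _ X_ne_zero
  refine ⟨C (X ^ k), ⟨(natDegree_C _).trans_le (Nat.zero_le n),
    zero_lt_one.trans_le (one_le_absL_evalP_C hq ξ hX), ?_⟩, ?_⟩
  · rw [neg_neg, Real.rpow_one, heightP_C hq ξ]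
  · rwa [heightP_C hq ξ, evalP, eval₂_C, absL_ringHomT hq hX, natDegree_X_pow]

theorem neg_two_le_wnStar (hq : 1 < q) (ξ : LaurentSeries Fq) {n : ℕ} (hn : 1 ≤ n) :
    ((-2 : ℝ) : EReal) ≤ wnStar Fq q n ξ := by
  have hq' : (1 : ℝ) < q := by exact_mod_cast hq
  obtain ⟨w, hna, hw, hwC⟩ := exists_absC_absoluteValue (Fq := Fq) hq
  refine le_sSup ⟨-2, infinite_of_unbounded w fun B => ?_, rfl⟩
  obtain ⟨k, hk⟩ := pow_unbounded_of_one_lt (max B (absL Fq q ξ)) hq'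
  have hX : (X ^ k : Polynomial Fq) ≠ 0 := pow_ne_zero _ X_ne_zero
  have hwα : w (ringHomTC Fq (X ^ k)) = (q : ℝ) ^ k := by
    rw [abv_ringHomTC hq hw hX, natDegree_X_pow]
  have hroot : evalPC Fq (ringHomTC Fq (X ^ k)) (X - C (X ^ k)) = 0 := by
    rw [evalPC, eval₂_sub, eval₂_X, eval₂_C, sub_self]
  have halg := isAlgT_of_evalPC_eq_zero (X_sub_C_ne_zero _) hroot
  have hlt : w (iota Fq ξ) < w (ringHomTC Fq (X ^ k)) := by
    rw [hw, hwα]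
    exact (le_max_right _ _).trans_lt hk
  refine ⟨ringHomTC Fq (X ^ k), ⟨halg, ?_, ?_, ?_⟩, ?_⟩
  · refine (degT_le_and_heightT_le hq (X_sub_C_ne_zero _) hroot).1.trans ?_
    rwa [natDegree_X_sub_C]
  · rw [← hwC]
    refine w.pos (sub_ne_zero.2 fun h => ?_)
    rw [h] at hlt
    exact lt_irrefl _ hlt
  · obtain ⟨P, hP, -, hheight⟩ := exists_isMinPolyOf (q := q) halg
    have h1 := max_one_abv_le_gaussNorm hna (one_le_abv_ringHomTC hq hw) hP.2.1.ne_zero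
      ((evalPC_eq_eval_map _ P).symm.trans hP.2.2.2.2)
    rw [gaussNorm_map_ringHomTC hq hw] at h1
    have h2 := hna (iota Fq ξ) (-ringHomTC Fq (X ^ k))
    rw [w.map_neg, max_eq_right hlt.le, ← sub_eq_add_neg] at h2
    rw [← hwC, hheight, show (-(-2) - 1 : ℝ) = 1 by norm_num, Real.rpow_one]
    exact h2.trans ((le_max_right _ _).trans h1)
  · rw [hwα]
    exact (le_max_left _ _).trans_lt hk

theorem le_of_one_le_rpow_mul {H c w d : ℝ} (hH : 1 ≤ H) (hw : d + 1 < w)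
    (h : 1 ≤ H ^ (-w) * (H ^ d * c)) : H ≤ c := by
  have hH0 : 0 < H := zero_lt_one.trans_le hH
  have hc : 0 < c := by
    by_contra! hc
    have : H ^ (-w) * (H ^ d * c) ≤ 0 :=
      mul_nonpos_of_nonneg_of_nonpos (by positivity)
        (mul_nonpos_of_nonneg_of_nonpos (by positivity) hc)
    linarith
  rw [← mul_assoc, ← Real.rpow_add hH0] at h
  have h1 : H ^ (-w + d) ≤ H ^ (-1 : ℝ) := Real.rpow_le_rpow_of_exponent_le hH (by linarith)
  rw [Real.rpow_neg_one] at h1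
  have h2 : 1 ≤ H⁻¹ * c := h.trans (by gcongr)
  rwa [← div_eq_inv_mul, one_le_div hH0] at h2

theorem wn_le_of_root [Finite Fq] (hq : 1 < q) {ξ : LaurentSeries Fq}
    {Q : Polynomial (Polynomial Fq)} (hQ : Irreducible Q) (hdeg : Q.natDegree ≠ 0)
    (hQξ : evalPC Fq (iota Fq ξ) Q = 0) (n : ℕ) :
    wn Fq q n ξ ≤ ((Q.natDegree : ℝ) : EReal) := by
  obtain ⟨w, hna, hw, hwC⟩ := exists_absC_absoluteValue (Fq := Fq) hq
  refine sSup_le ?_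
  rintro _ ⟨v, hv, rfl⟩
  refine EReal.coe_le_coe_iff.2 (not_lt.1 fun hlt => hv ?_)
  refine (finite_heightP_le (Fq := Fq) hq n (heightP Fq q Q ^ n)).subset ?_
  rintro P ⟨hPn, hpos, hle⟩
  refine ⟨hPn, ?_⟩
  rw [← abv_eval_map_iota hw] at hpos hle
  have hPx := w.ne_zero_iff.1 hpos.ne'
  have hP : P ≠ 0 := by
    rintro rfl
    simp at hPx
  have h := one_le_abv_eval_mul hna (one_le_abv_ringHomTC hq hw) hQ hdeg
    ((evalPC_eq_eval_map _ Q).symm.trans hQξ) hPx hPn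
  rw [gaussNorm_map_ringHomTC hq hw, gaussNorm_map_ringHomTC hq hw] at h
  refine le_of_one_le_rpow_mul (w := v) (d := ((Q.natDegree - 1 : ℕ) : ℝ))
    (one_le_heightP hq hP) ?_ (h.trans ?_)
  · rw [Nat.cast_sub (Nat.one_le_iff_ne_zero.2 hdeg)]
    push_cast
    linarith
  · rw [Real.rpow_natCast]
    have h1 := heightP_nonneg (q := q) P
    have h2 := heightP_nonneg (q := q) Q
    gcongr

theorem wnStar_le_of_root [Finite Fq] (hq : 1 < q) {ξ : LaurentSeries Fq}
    {Q : Polynomial (Polynomial Fq)} (hQ : Irreducible Q) (hdeg : Q.natDegree ≠ 0)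
    (hQξ : evalPC Fq (iota Fq ξ) Q = 0) (n : ℕ) :
    wnStar Fq q n ξ ≤ ((Q.natDegree : ℝ) : EReal) := by
  obtain ⟨w, hna, hw, hwC⟩ := exists_absC_absoluteValue (Fq := Fq) hq
  refine sSup_le ?_
  rintro _ ⟨v, hv, rfl⟩
  refine EReal.coe_le_coe_iff.2 (not_lt.1 fun hlt => hv ?_)
  set M : ℝ := max 1 (w (iota Fq ξ)) with hM
  have hM0 : 0 < M := by positivity
  refine (((finite_heightP_le (Fq := Fq) hq n (M ^ n * heightP Fq q Q ^ n)).insert Q).biUnion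
    fun P _ => (P.map (ringHomTC Fq)).roots.toFinset.finite_toSet).subset ?_
  rintro α ⟨halg, hαn, hpos, hle⟩
  obtain ⟨P, hP, hPdeg, hPheight⟩ := exists_isMinPolyOf (q := q) halg
  have hroot : ∀ R : Polynomial (Polynomial Fq), R ≠ 0 → evalPC Fq α R = 0 →
      α ∈ ((R.map (ringHomTC Fq)).roots.toFinset : Set (AC Fq)) := by
    intro R hR hRα
    rw [Finset.mem_coe, Multiset.mem_toFinset,
      mem_roots ((Polynomial.map_ne_zero_iff ringHomTC_injective).2 hR), IsRoot,
      ← evalPC_eq_eval_map]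
    exact hRα
  by_cases hQα : evalPC Fq α Q = 0
  · exact Set.mem_biUnion (Set.mem_insert Q _) (hroot Q hQ.ne_zero hQα)
  refine Set.mem_biUnion (Set.mem_insert_of_mem Q ?_) (hroot P hP.2.1.ne_zero hP.2.2.2.2)
  rw [hPdeg] at hαn
  refine ⟨hαn, ?_⟩
  have hPx : (P.map (ringHomTC Fq)).eval (iota Fq ξ) ≠ 0 := by
    intro h0
    obtain ⟨R, hR⟩ : P ∣ Q := dvd_of_common_root ringHomTC_injective hP.2.1 hP.1.ne'
      ((evalPC_eq_eval_map _ P).trans h0) hQξ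
    refine hQα ?_
    rw [hR, evalPC, eval₂_mul]
    exact mul_eq_zero_of_left hP.2.2.2.2 _
  have h := one_le_abv_eval_mul hna (one_le_abv_ringHomTC hq hw) hQ hdeg
    ((evalPC_eq_eval_map _ Q).symm.trans hQξ) hPx hαn
  have h' := abv_eval_le_abv_sub_mul hna
    ((Polynomial.map_ne_zero_iff ringHomTC_injective).2 hP.2.1.ne_zero)
    ((evalPC_eq_eval_map _ P).symm.trans hP.2.2.2.2) (iota Fq ξ)
    (natDegree_map_le.trans hαn)
  rw [gaussNorm_map_ringHomTC hq hw, gaussNorm_map_ringHomTC hq hw] at h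
  rw [gaussNorm_map_ringHomTC hq hw, ← hM] at h'
  rw [← hwC, hPheight] at hle
  have hH := one_le_heightP hq hP.2.1.ne_zero
  have hH0 := heightP_nonneg (q := q) P
  have hQ0 := heightP_nonneg (q := q) Q
  refine le_of_one_le_rpow_mul (w := v + 1) (d := (Q.natDegree : ℝ)) hH (by linarith) ?_
  rw [Real.rpow_natCast]
  calc 1 ≤ _ := h
    _ ≤ (heightP Fq q P ^ (-v - 1) * (M ^ n * heightP Fq q P)) *
        (heightP Fq q P ^ (Q.natDegree - 1) * heightP Fq q Q ^ n) := by
        gcongr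
        exact h'.trans (by gcongr)
    _ = heightP Fq q P ^ (-v - 1) * (heightP Fq q P ^ (Q.natDegree - 1 + 1) *
        (M ^ n * heightP Fq q Q ^ n)) := by ring
    _ = _ := by
        rw [Nat.sub_add_cancel (Nat.one_le_iff_ne_zero.2 hdeg), neg_add']

theorem limsup_div_nat_eq_zero {a : ℕ → EReal} {b c : ℝ}
    (h : ∀ᶠ n in atTop, (b : EReal) ≤ a n ∧ a n ≤ (c : EReal)) :
    limsup (fun n : ℕ => a n / (n : EReal)) atTop = 0 := by
  have hlim : ∀ r : ℝ, Tendsto (fun n : ℕ => (r : EReal) / (n : EReal)) atTop (nhds 0) := by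
    intro r
    have := (continuous_coe_real_ereal.tendsto 0).comp (tendsto_const_div_atTop_nhds_zero_nat r)
    refine this.congr fun n => ?_
    simp [EReal.coe_div]
  refine (tendsto_of_tendsto_of_tendsto_of_le_of_le' (hlim b) (hlim c) ?_ ?_).limsup_eq
  · filter_upwards [h] with n hn
    exact EReal.div_le_div_right_of_nonneg (by positivity) hn.1
  · filter_upwards [h] with n hn
    exact EReal.div_le_div_right_of_nonneg (by positivity) hn.2

theorem limsup_div_nat_ne_zero {a : ℕ → EReal} {b c : ℝ} (hc : 0 < c)
    (h : ∀ᶠ n : ℕ in atTop, ((c * n - b : ℝ) : EReal) ≤ a n) :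
    limsup (fun n : ℕ => a n / (n : EReal)) atTop ≠ 0 := by
  have hle : ((c / 2 : ℝ) : EReal) ≤ limsup (fun n : ℕ => a n / (n : EReal)) atTop := by
    rw [← limsup_const (f := (atTop : Filter ℕ)) ((c / 2 : ℝ) : EReal)]
    refine limsup_le_limsup ?_
    filter_upwards [h, eventually_gt_atTop 0,
      tendsto_natCast_atTop_atTop.eventually_ge_atTop (2 * b / c)] with n hn hpos hlarge
    have hpos' : (0 : ℝ) < n := by exact_mod_cast hpos
    refine le_trans ?_ (EReal.div_le_div_right_of_nonneg (by positivity) hn)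
    rw [← EReal.coe_natCast, ← EReal.coe_div, EReal.coe_le_coe_iff, le_div_iff₀ hpos']
    rw [div_le_iff₀ hc] at hlarge
    linarith
  have hpos : (0 : EReal) < ((c / 2 : ℝ) : EReal) := by
    rw [EReal.coe_pos]
    positivity
  exact (hpos.trans_le hle).ne'

theorem isANumber_iff_isAlgLS [Fintype Fq] (hq : 1 < q) (ξ : LaurentSeries Fq) :
    IsANumber Fq q ξ ↔ IsAlgLS Fq ξ := by
  constructor
  · intro h
    by_contra hξ
    refine limsup_div_nat_ne_zero (b := 0) (c := 1 / 2) (by norm_num) ?_ h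
    filter_upwards [eventually_ge_atTop 1] with n hn
    convert half_le_wn hq hξ hn using 2
    ring
  · rintro ⟨P, hP, hPξ⟩
    obtain ⟨Q, hQ, hdeg, hQξ⟩ := exists_irreducible_evalPC_eq_zero (α := iota Fq ξ) hP
      (by rw [evalPC_iota, hPξ, map_zero])
    exact limsup_div_nat_eq_zero (Eventually.of_forall fun n =>
      ⟨neg_one_le_wn hq ξ n, wn_le_of_root hq hQ hdeg hQξ n⟩)

theorem isAStarNumber_iff_isAlgLS [Fintype Fq] (hq : 1 < q) (ξ : LaurentSeries Fq) :
    IsAStarNumber Fq q ξ ↔ IsAlgLS Fq ξ := by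
  constructor
  · intro h
    by_contra hξ
    refine limsup_div_nat_ne_zero (b := 3) (c := 1 / 16) (by norm_num) ?_ h
    filter_upwards [eventually_ge_atTop 48] with n hn
    convert le_wnStar hq hξ hn using 2
    ring
  · rintro ⟨P, hP, hPξ⟩
    obtain ⟨Q, hQ, hdeg, hQξ⟩ := exists_irreducible_evalPC_eq_zero (α := iota Fq ξ) hP
      (by rw [evalPC_iota, hPξ, map_zero])
    refine limsup_div_nat_eq_zero (b := -2) (c := Q.natDegree) ?_
    filter_upwards [eventually_ge_atTop 1] with n hn
    exact ⟨neg_two_le_wnStar hq ξ hn, wnStar_le_of_root hq hQ hdeg hQξ n⟩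

end Algebraic

/-- For `ξ ∈ F_q((T⁻¹))`, the following are equivalent: `ξ` is an
`A`-number; `ξ` is an `A*`-number; `ξ` is algebraic over `F_q(T)`. -/
theorem aNumber_tfae (p : ℕ) (hp : p.Prime) (q : ℕ) (hq : ∃ e : ℕ, 0 < e ∧ q = p ^ e)
    (Fq : Type) [Field Fq] [Fintype Fq] [CharP Fq p] (hcard : Fintype.card Fq = q)
    (ξ : LaurentSeries Fq) :
    (IsANumber Fq q ξ ↔ IsAStarNumber Fq q ξ) ∧ (IsANumber Fq q ξ ↔ IsAlgLS Fq ξ) := by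
  have hq1 : 1 < q := by
    rw [← hcard]
    exact Fintype.one_lt_card
  exact ⟨(isANumber_iff_isAlgLS hq1 ξ).trans (isAStarNumber_iff_isAlgLS hq1 ξ).symm,
    isANumber_iff_isAlgLS hq1 ξ⟩
end
end

section
/- Let ξ, η ∈ F_q((T^{-1})) be transcendental over F_q(T). If ξ and η are algebraically dependent over F_q(T), then ξ and η lie in the same Mahler class: ξ is an S-number iff η is an S-number, ξ is a T-number iff η is a T-number, and ξ is a U-number iff η is a U-number. -/
open Polynomial Filter Set
open scoped Classical

noncomputable section

open OotoT

namespace OotoT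

open scoped Matrix

section Companion

variable {B L : Type*} [CommRing B] [CommRing L]

/-- The companion matrix of `F`, scaled by its leading coefficient. -/
def scaledCompanion (F : B[X]) : Matrix (Fin F.natDegree) (Fin F.natDegree) B := fun i j =>
  if (i : ℕ) + 1 = F.natDegree then -F.coeff j
  else if (j : ℕ) = i + 1 then F.leadingCoeff else 0

/-- The homogenization of `P` in degree `n`, evaluated at the scaled companion matrix of `F`
and the leading coefficient of `F`. -/
def companionEval (F : B[X]) (n : ℕ) (P : B[X]) :
    Matrix (Fin F.natDegree) (Fin F.natDegree) B :=
  ∑ k ∈ Finset.range (n + 1), (P.coeff k * F.leadingCoeff ^ (n - k)) • scaledCompanion F ^ k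

/-- The vector of powers `(1, y, …, y ^ (d - 1))`. -/
def powerVec (y : L) (d : ℕ) : Fin d → L := fun i => y ^ (i : ℕ)

lemma scaledCompanion_mulVec (φ : B →+* L) (y : L) (F : B[X]) (hF : F.eval₂ φ y = 0) :
    (scaledCompanion F).map φ *ᵥ powerVec y F.natDegree =
      (φ F.leadingCoeff * y) • powerVec y F.natDegree := by
  funext i
  simp only [Matrix.mulVec, dotProduct, Matrix.map_apply, powerVec, Pi.smul_apply, smul_eq_mul,
    scaledCompanion]
  by_cases hi : (i : ℕ) + 1 = F.natDegree
  · simp only [hi, if_true, map_neg, neg_mul, Finset.sum_neg_distrib]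
    rw [Polynomial.eval₂_eq_sum_range, Finset.sum_range_succ, Finset.sum_range] at hF
    rw [eq_comm, mul_assoc, ← pow_succ', hi, eq_neg_iff_add_eq_zero, add_comm]
    exact hF
  · have hlt : (i : ℕ) + 1 < F.natDegree := lt_of_le_of_ne i.2 hi
    rw [Finset.sum_eq_single (⟨i + 1, hlt⟩ : Fin F.natDegree)]
    · simp only [hi, if_false, if_true]; ring
    · intro j _ hj
      have : (j : ℕ) ≠ i + 1 := fun h => hj (Fin.ext h)
      simp [hi, this]
    · simp

lemma scaledCompanion_pow_mulVec (φ : B →+* L) (y : L) (F : B[X]) (hF : F.eval₂ φ y = 0)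
    (k : ℕ) :
    (scaledCompanion F ^ k).map φ *ᵥ powerVec y F.natDegree =
      (φ F.leadingCoeff * y) ^ k • powerVec y F.natDegree := by
  induction k with
  | zero => simp [Matrix.map_one]
  | succ k ih =>
    rw [pow_succ, Matrix.map_mul, ← Matrix.mulVec_mulVec, scaledCompanion_mulVec φ y F hF,
      Matrix.mulVec_smul, ih, smul_smul, ← pow_succ']

lemma companionEval_mulVec (φ : B →+* L) (y : L) (F : B[X]) (hF : F.eval₂ φ y = 0)
    (n : ℕ) (P : B[X]) (hP : P.natDegree ≤ n) :
    (companionEval F n P).map φ *ᵥ powerVec y F.natDegree =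
      (φ F.leadingCoeff ^ n * P.eval₂ φ y) • powerVec y F.natDegree := by
  have hmap : (companionEval F n P).map φ = ∑ k ∈ Finset.range (n + 1),
      φ (P.coeff k * F.leadingCoeff ^ (n - k)) • (scaledCompanion F ^ k).map φ := by
    ext i j
    simp [companionEval, Matrix.sum_apply, Matrix.map_apply]
  rw [hmap, Matrix.sum_mulVec, Polynomial.eval₂_eq_sum_range' φ (Nat.lt_succ_of_le hP),
    Finset.mul_sum, Finset.sum_smul]
  refine Finset.sum_congr rfl fun k hk => ?_
  rw [Matrix.smul_mulVec, scaledCompanion_pow_mulVec φ y F hF, smul_smul]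
  congr 1
  have hk' : n = (n - k) + k := by have := Finset.mem_range.1 hk; omega
  conv_rhs => rw [hk', pow_add]
  rw [map_mul, map_pow, mul_pow]
  ring

lemma det_companionEval_ne_zero [IsDomain B] [IsDomain L] (φ : B →+* L)
    (hφ : Function.Injective φ) (y : L) (F : B[X]) (hF0 : F ≠ 0) (hF : F.eval₂ φ y = 0)
    (hmin : ∀ Q : B[X], Q ≠ 0 → Q.eval₂ φ y = 0 → F.natDegree ≤ Q.natDegree)
    (n : ℕ) (P : B[X]) (hP : P.natDegree ≤ n) (hPy : P.eval₂ φ y ≠ 0) :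
    (companionEval F n P).det ≠ 0 := by
  intro hdet
  obtain ⟨c, hc0, hc⟩ := Matrix.exists_vecMul_eq_zero_iff.2 hdet
  have hkey : (φ ∘ c) ⬝ᵥ ((companionEval F n P).map φ *ᵥ powerVec y F.natDegree) = 0 := by
    have hvec : (φ ∘ c) ᵥ* (companionEval F n P).map φ = 0 := by
      funext i
      rw [← RingHom.map_vecMul, hc]
      simp
    rw [Matrix.dotProduct_mulVec, hvec, zero_dotProduct]
  rw [companionEval_mulVec φ y F hF n P hP, dotProduct_smul, smul_eq_mul] at hkey
  have hlead : φ F.leadingCoeff ≠ 0 := by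
    rw [Ne, map_eq_zero_iff φ hφ]; exact Polynomial.leadingCoeff_ne_zero.2 hF0
  have hzero := (mul_eq_zero.1 hkey).resolve_left (mul_ne_zero (pow_ne_zero _ hlead) hPy)
  let Q : B[X] := ∑ i : Fin F.natDegree, Polynomial.monomial (i : ℕ) (c i)
  have hcoeff : ∀ i : Fin F.natDegree, Q.coeff i = c i := by
    intro i
    simp [Q, Polynomial.coeff_monomial, Fin.val_inj]
  have hQ0 : Q ≠ 0 := by
    intro h
    apply hc0
    funext i
    rw [← hcoeff, h]; simp
  have hQy : Q.eval₂ φ y = 0 := by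
    simp only [Q, Polynomial.eval₂_finsetSum, Polynomial.eval₂_monomial]
    exact hzero
  have hdeg : Q.degree < F.natDegree := by
    refine (Polynomial.degree_sum_le _ _).trans_lt ?_
    rw [Finset.sup_lt_iff (WithBot.bot_lt_coe _)]
    intro i _
    exact (Polynomial.degree_monomial_le _ _).trans_lt (by exact_mod_cast i.2)
  exact absurd (hmin Q hQ0 hQy) (not_le.2 ((Polynomial.natDegree_lt_iff_degree_lt hQ0).2 hdeg))

/-- Cramer's rule applied to the companion evaluation. -/
lemma map_det_companionEval (φ : B →+* L) (y : L) (F : B[X]) (hF : F.eval₂ φ y = 0)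
    (hpos : 0 < F.natDegree) (n : ℕ) (P : B[X]) (hP : P.natDegree ≤ n) :
    φ (companionEval F n P).det = ∑ j : Fin F.natDegree,
      φ ((companionEval F n P).adjugate ⟨0, hpos⟩ j) *
        ((φ F.leadingCoeff ^ n * P.eval₂ φ y) * y ^ (j : ℕ)) := by
  have h := congrArg (fun A : Matrix (Fin F.natDegree) (Fin F.natDegree) B =>
    (A.map φ *ᵥ powerVec y F.natDegree) ⟨0, hpos⟩) (companionEval F n P).adjugate_mul
  simp only [Matrix.map_mul, ← Matrix.mulVec_mulVec, companionEval_mulVec φ y F hF n P hP] at h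
  simpa [Matrix.mulVec, dotProduct, powerVec, Matrix.one_apply, Matrix.map_apply, apply_ite φ]
    using h.symm

end Companion

section Bounds

variable {K : Type*} [Field K]

/-- `b ∈ K[T][X]` has degree at most `a` in `X` and at most `h` in `T`. -/
def BidegreeLE (a h : ℕ) (b : K[X][X]) : Prop :=
  b.natDegree ≤ a ∧ ∀ i, (b.coeff i).natDegree ≤ h

namespace BidegreeLE

variable {a a' h h' : ℕ} {b b' : K[X][X]}

lemma mono (hb : BidegreeLE a h b) (ha : a ≤ a') (hh : h ≤ h') : BidegreeLE a' h' b :=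
  ⟨hb.1.trans ha, fun i => (hb.2 i).trans hh⟩

lemma C_apply {c : K[X]} (hc : c.natDegree ≤ h) : BidegreeLE 0 h (C c) := by
  refine ⟨by simp, fun i => ?_⟩
  rw [Polynomial.coeff_C]
  split_ifs <;> simp [hc]

lemma zero : BidegreeLE a h (0 : K[X][X]) := ⟨by simp, by simp⟩

lemma one : BidegreeLE a h (1 : K[X][X]) := by
  have : BidegreeLE 0 0 (C 1 : K[X][X]) := C_apply (by simp)
  rw [map_one] at this
  exact this.mono (Nat.zero_le _) (Nat.zero_le _)

lemma neg (hb : BidegreeLE a h b) : BidegreeLE a h (-b) :=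
  ⟨by simpa using hb.1, fun i => by simpa using hb.2 i⟩

lemma mul (hb : BidegreeLE a h b) (hb' : BidegreeLE a' h' b') :
    BidegreeLE (a + a') (h + h') (b * b') := by
  refine ⟨Polynomial.natDegree_mul_le.trans (add_le_add hb.1 hb'.1), fun i => ?_⟩
  rw [Polynomial.coeff_mul]
  exact Polynomial.natDegree_sum_le_of_forall_le _ _ fun x _ =>
    Polynomial.natDegree_mul_le.trans (add_le_add (hb.2 _) (hb'.2 _))

lemma sum {ι : Type*} {s : Finset ι} {f : ι → K[X][X]} (hf : ∀ i ∈ s, BidegreeLE a h (f i)) :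
    BidegreeLE a h (∑ i ∈ s, f i) := by
  refine ⟨Polynomial.natDegree_sum_le_of_forall_le _ _ fun i hi => (hf i hi).1, fun k => ?_⟩
  rw [Polynomial.finsetSum_coeff]
  exact Polynomial.natDegree_sum_le_of_forall_le _ _ fun i hi => (hf i hi).2 k

lemma prod {ι : Type*} {s : Finset ι} {f : ι → K[X][X]} (hf : ∀ i ∈ s, BidegreeLE a h (f i)) :
    BidegreeLE (s.card * a) (s.card * h) (∏ i ∈ s, f i) := by
  induction s using Finset.cons_induction with
  | empty => simpa using one
  | cons i s hi ih =>
    rw [Finset.prod_cons, Finset.card_cons]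
    refine ((hf i (Finset.mem_cons_self i s)).mul
      (ih fun j hj => hf j (Finset.mem_cons_of_mem hj))).mono (le_of_eq ?_) (le_of_eq ?_) <;> ring

lemma pow (hb : BidegreeLE a h b) (k : ℕ) : BidegreeLE (k * a) (k * h) (b ^ k) := by
  simpa using prod (s := Finset.range k) (f := fun _ => b) fun _ _ => hb

lemma det {d : ℕ} {A : Matrix (Fin d) (Fin d) K[X][X]} (hA : ∀ i j, BidegreeLE a h (A i j)) :
    BidegreeLE (d * a) (d * h) A.det := by
  rw [Matrix.det_apply]
  refine sum fun σ _ => ?_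
  have hp : BidegreeLE (d * a) (d * h) (∏ i, A (σ i) i) := by
    simpa using prod (s := Finset.univ) (f := fun i => A (σ i) i) fun i _ => hA _ _
  rcases Int.units_eq_one_or (Equiv.Perm.sign σ) with hs | hs
  · simpa [hs] using hp
  · simpa [hs] using hp.neg

lemma adjugate {d : ℕ} {A : Matrix (Fin d) (Fin d) K[X][X]}
    (hA : ∀ i j, BidegreeLE a h (A i j)) (i j : Fin d) :
    BidegreeLE (d * a) (d * h) (A.adjugate i j) := by
  rw [Matrix.adjugate_apply]
  refine det fun k l => ?_
  rw [Matrix.updateRow_apply]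
  split_ifs
  · rw [Pi.single_apply]
    split_ifs
    exacts [one, zero]
  · exact hA k l

lemma matrix_pow {d : ℕ} {A : Matrix (Fin d) (Fin d) K[X][X]}
    (hA : ∀ i j, BidegreeLE a h (A i j)) (k : ℕ) (i j : Fin d) :
    BidegreeLE (k * a) (k * h) ((A ^ k) i j) := by
  induction k generalizing i j with
  | zero =>
    rw [pow_zero, Matrix.one_apply]
    split_ifs
    exacts [one, zero]
  | succ k ih =>
    rw [pow_succ, Matrix.mul_apply, Nat.succ_mul, Nat.succ_mul]
    exact sum fun l _ => (ih i l).mul (hA l j)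

lemma companionEval {F : K[X][X][X]} (hF : ∀ i, BidegreeLE a h (F.coeff i)) {n : ℕ} {P : K[X][X]}
    (hP : BidegreeLE n h' P) (i j : Fin F.natDegree) :
    BidegreeLE (n * a) (h' + n * h) (companionEval F n (P.map C) i j) := by
  have hG : ∀ i j, BidegreeLE a h (scaledCompanion F i j) := by
    intro i j
    unfold scaledCompanion
    split_ifs
    exacts [(hF _).neg, hF _, zero]
  rw [OotoT.companionEval, Matrix.sum_apply]
  refine sum fun k hk => ?_
  rw [Matrix.smul_apply, smul_eq_mul, Polynomial.coeff_map]
  have hk' : n = (n - k) + k := by have := Finset.mem_range.1 hk; omega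
  refine (((C_apply (hP.2 k)).mul ((hF F.natDegree).pow (n - k))).mul
    (matrix_pow hG k i j)).mono (le_of_eq ?_) (le_of_eq ?_)
  · conv_rhs => rw [hk']
    ring
  · conv_rhs => rw [hk']
    ring

end BidegreeLE

/-- The degree in `T` of an element of `K[T][X]`. -/
def innerDegree (b : K[X][X]) : ℕ := b.support.sup fun i => (b.coeff i).natDegree

lemma natDegree_coeff_le_innerDegree (b : K[X][X]) (i : ℕ) :
    (b.coeff i).natDegree ≤ innerDegree b := by
  by_cases hi : i ∈ b.support
  · exact Finset.le_sup (f := fun i => (b.coeff i).natDegree) hi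
  · simp [Polynomial.notMem_support_iff.1 hi]

lemma exists_forall_bidegreeLE_coeff (F : K[X][X][X]) :
    ∃ a h, ∀ i, BidegreeLE a h (F.coeff i) := by
  refine ⟨F.support.sup fun i => (F.coeff i).natDegree,
    F.support.sup fun i => innerDegree (F.coeff i), fun i => ?_⟩
  by_cases hi : i ∈ F.support
  · exact ⟨Finset.le_sup (f := fun i => (F.coeff i).natDegree) hi, fun k =>
      (natDegree_coeff_le_innerDegree _ k).trans
        (Finset.le_sup (f := fun i => innerDegree (F.coeff i)) hi)⟩
  · rw [Polynomial.notMem_support_iff.1 hi]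
    exact BidegreeLE.zero

lemma finite_bidegreeLE [Finite K] (a h : ℕ) : {b : K[X][X] | BidegreeLE a h b}.Finite := by
  refine Set.Finite.of_finite_image (f := fun b => fun (i : Fin (a + 1)) (j : Fin (h + 1)) =>
    (b.coeff i).coeff j) (Set.toFinite _) ?_
  intro b hb c hc hbc
  ext i j
  by_cases hi : i < a + 1
  · by_cases hj : j < h + 1
    · exact congrFun (congrFun hbc ⟨i, hi⟩) ⟨j, hj⟩
    · rw [Polynomial.coeff_eq_zero_of_natDegree_lt (by have := hb.2 i; omega),
        Polynomial.coeff_eq_zero_of_natDegree_lt (by have := hc.2 i; omega)]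
  · rw [Polynomial.coeff_eq_zero_of_natDegree_lt (n := i) (by have := hb.1; omega),
      Polynomial.coeff_eq_zero_of_natDegree_lt (n := i) (by have := hc.1; omega)]

end Bounds

section AbsoluteValue

variable {Fq : Type} [Field Fq] {q : ℕ}

lemma absL_nonneg (x : LaurentSeries Fq) : 0 ≤ absL Fq q x := by
  unfold absL
  split_ifs
  · exact le_rfl
  · positivity

lemma absL_zero : absL Fq q 0 = 0 := by simp [absL]

lemma absL_pos (hq : 1 < q) {x : LaurentSeries Fq} : 0 < absL Fq q x ↔ x ≠ 0 := by
  unfold absL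
  split_ifs with hx
  · simp [hx]
  · have : (0 : ℝ) < q := by positivity
    simp [hx, zpow_pos this]

lemma absL_mul (hq : 1 < q) (x y : LaurentSeries Fq) :
    absL Fq q (x * y) = absL Fq q x * absL Fq q y := by
  by_cases hx : x = 0
  · simp [hx, absL_zero]
  by_cases hy : y = 0
  · simp [hy, absL_zero]
  have : (q : ℝ) ≠ 0 := by positivity
  simp [absL, hx, hy, HahnSeries.order_mul hx hy, zpow_add₀ this, mul_comm]

lemma absL_one : absL Fq q 1 = 1 := by simp [absL]

lemma absL_pow (hq : 1 < q) (x : LaurentSeries Fq) (n : ℕ) :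
    absL Fq q (x ^ n) = absL Fq q x ^ n := by
  induction n with
  | zero => simp [absL_one]
  | succ n ih => rw [pow_succ, pow_succ, absL_mul hq, ih]

lemma absL_add_le (hq : 1 < q) {x y : LaurentSeries Fq} {r : ℝ}
    (hx : absL Fq q x ≤ r) (hy : absL Fq q y ≤ r) : absL Fq q (x + y) ≤ r := by
  by_cases hx0 : x = 0
  · simpa [hx0] using hy
  by_cases hy0 : y = 0
  · simpa [hy0] using hx
  by_cases hxy : x + y = 0
  · rw [hxy, absL_zero]; exact (absL_nonneg _).trans hx
  have hq1 : (1 : ℝ) ≤ q := by exact_mod_cast hq.le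
  have hmin := HahnSeries.min_order_le_order_add hxy
  simp only [absL, hx0, hy0, hxy, if_false] at *
  rcases min_le_iff.1 hmin with h | h
  · exact (zpow_le_zpow_right₀ hq1 (neg_le_neg h)).trans hx
  · exact (zpow_le_zpow_right₀ hq1 (neg_le_neg h)).trans hy

lemma absL_sum_le (hq : 1 < q) {ι : Type*} {s : Finset ι} {f : ι → LaurentSeries Fq} {r : ℝ}
    (hr : 0 ≤ r) (hf : ∀ i ∈ s, absL Fq q (f i) ≤ r) : absL Fq q (∑ i ∈ s, f i) ≤ r := by
  induction s using Finset.cons_induction with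
  | empty => simpa [absL_zero] using hr
  | cons i s hi ih =>
    rw [Finset.sum_cons]
    exact absL_add_le hq (hf i (Finset.mem_cons_self i s))
      (ih fun j hj => hf j (Finset.mem_cons_of_mem hj))

lemma absL_ringHomT_le (hq : 1 < q) {c : Fq[X]} {h : ℕ} (hc : c.natDegree ≤ h) :
    absL Fq q (ringHomT Fq c) ≤ (q : ℝ) ^ h := by
  have hq1 : (1 : ℝ) ≤ q := by exact_mod_cast hq.le
  have hT : absL Fq q (Tel Fq) = q := by
    have hne : (HahnSeries.single (1 : ℤ) (1 : Fq)) ≠ 0 := by simp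
    have h1 : absL Fq q (HahnSeries.single (1 : ℤ) (1 : Fq)) = (q : ℝ)⁻¹ := by
      simp [absL, HahnSeries.order_single]
    have h2 : absL Fq q (HahnSeries.single (1 : ℤ) (1 : Fq)) * absL Fq q (Tel Fq) = 1 := by
      rw [← absL_mul hq, Tel, mul_inv_cancel₀ hne, absL_one]
    rw [h1] at h2
    have : (q : ℝ) ≠ 0 := by positivity
    field_simp at h2
    exact h2
  have hC : ∀ x : Fq, absL Fq q (HahnSeries.C x) ≤ 1 := by
    intro x
    unfold absL
    split_ifs
    · exact zero_le_one
    · rw [HahnSeries.order_C]; simp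
  rw [ringHomT, Polynomial.coe_eval₂RingHom, Polynomial.eval₂_eq_sum_range]
  refine absL_sum_le hq (by positivity) fun i hi => ?_
  rw [absL_mul hq, absL_pow hq, hT]
  calc _ ≤ 1 * (q : ℝ) ^ i := by gcongr; exact hC _
    _ ≤ (q : ℝ) ^ h := by
      rw [one_mul]
      exact pow_le_pow_right₀ hq1 (by have := Finset.mem_range.1 hi; omega)

lemma absL_evalP_le (hq : 1 < q) (ξ : LaurentSeries Fq) {a h : ℕ} {b : Fq[X][X]}
    (hb : BidegreeLE a h b) :
    absL Fq q (evalP Fq ξ b) ≤ (q : ℝ) ^ h * max 1 (absL Fq q ξ) ^ a := by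
  rw [evalP, Polynomial.eval₂_eq_sum_range]
  have h0 := absL_nonneg (q := q) ξ
  refine absL_sum_le hq (by positivity) fun i hi => ?_
  rw [absL_mul hq, absL_pow hq]
  have hi' : i ≤ a := by have := Finset.mem_range.1 hi; have := hb.1; omega
  calc _ ≤ (q : ℝ) ^ h * max 1 (absL Fq q ξ) ^ i := by
        gcongr
        · exact absL_ringHomT_le hq (hb.2 i)
        · exact le_max_right _ _
    _ ≤ _ := by
        gcongr
        exact le_max_left _ _

lemma heightP_of_ne_zero {P : Fq[X][X]} (hP : P ≠ 0) :
    heightP Fq q P = (q : ℝ) ^ innerDegree P := by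
  simp [heightP, innerDegree, hP]

lemma heightP_le (hq : 1 < q) {a h : ℕ} {P : Fq[X][X]} (hP : BidegreeLE a h P) :
    heightP Fq q P ≤ (q : ℝ) ^ h := by
  by_cases h0 : P = 0
  · simp only [heightP, h0, if_true]; positivity
  · rw [heightP_of_ne_zero h0]
    have hq1 : (1 : ℝ) ≤ q := by exact_mod_cast hq.le
    exact pow_le_pow_right₀ hq1 (Finset.sup_le fun i _ => hP.2 i)

lemma one_le_heightP (hq : 1 < q) {P : Fq[X][X]} (hP : P ≠ 0) : 1 ≤ heightP Fq q P := by
  rw [heightP_of_ne_zero hP]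
  exact one_le_pow₀ (by exact_mod_cast hq.le)

end AbsoluteValue

section Transfer

variable {Fq : Type} [Field Fq] {q : ℕ} {ξ η : LaurentSeries Fq}

lemma AlgDep.symm (hdep : AlgDep Fq ξ η) : AlgDep Fq η ξ := by
  obtain ⟨F, hF0, hF⟩ := hdep
  let e := Polynomial.Bivariate.swap (R := Fq[X])
  refine ⟨e F, (map_ne_zero_iff e e.injective).2 hF0, ?_⟩
  have hcomp : (Polynomial.eval₂RingHom (Polynomial.eval₂RingHom (ringHomT Fq) η) ξ).comp
      (e : Fq[X][X][X] →+* Fq[X][X][X]) =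
        Polynomial.eval₂RingHom (Polynomial.eval₂RingHom (ringHomT Fq) ξ) η := by
    refine Polynomial.ringHom_ext' (Polynomial.ringHom_ext' ?_ ?_) ?_
    · ext <;> simp [e, Polynomial.Bivariate.swap_C_C]
    · simp [e, Polynomial.Bivariate.swap_X]
    · simp [e, Polynomial.Bivariate.swap_Y]
  rw [← hF]
  exact RingHom.congr_fun hcomp F

/-- Every polynomial with a nonzero value at `η` gives rise to a polynomial with a nonzero value
at `ξ`, with controlled degree, height and value. -/
lemma exists_transfer (hq : 1 < q) (hξ : ¬ IsAlgLS Fq ξ) (hdep : AlgDep Fq ξ η) :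
    ∃ M K : ℕ, 0 < M ∧ 0 < K ∧ ∀ n : ℕ, ∃ c : ℝ, 1 ≤ c ∧ ∀ P : Fq[X][X], P.natDegree ≤ n →
      evalP Fq η P ≠ 0 → ∃ D : Fq[X][X], D.natDegree ≤ K * n ∧ evalP Fq ξ D ≠ 0 ∧
        absL Fq q (evalP Fq ξ D) ≤ c * heightP Fq q P ^ M * absL Fq q (evalP Fq η P) ∧
        heightP Fq q D ≤ c * heightP Fq q P ^ M := by
  set φ : Fq[X][X] →+* LaurentSeries Fq := Polynomial.eval₂RingHom (ringHomT Fq) ξ with hφdef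
  have hφ : Function.Injective φ := by
    rw [injective_iff_map_eq_zero]
    intro b hb
    by_contra hb0
    exact hξ ⟨b, hb0, hb⟩
  obtain ⟨F, ⟨hF0, hF⟩, hmin⟩ := WellFounded.has_min
    (measure (Polynomial.natDegree : Fq[X][X][X] → ℕ)).wf
    {F : Fq[X][X][X] | F ≠ 0 ∧ F.eval₂ φ η = 0} hdep
  replace hmin : ∀ Q : Fq[X][X][X], Q ≠ 0 → Q.eval₂ φ η = 0 → F.natDegree ≤ Q.natDegree :=
    fun Q hQ0 hQ => not_lt.1 (hmin Q ⟨hQ0, hQ⟩)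
  have hpos : 0 < F.natDegree := by
    rw [Nat.pos_iff_ne_zero]
    intro h0
    rw [Polynomial.eq_C_of_natDegree_eq_zero h0, Polynomial.eval₂_C, map_eq_zero_iff φ hφ] at hF
    rw [Polynomial.eq_C_of_natDegree_eq_zero h0, hF] at hF0
    simp at hF0
  obtain ⟨a, l, hal⟩ := exists_forall_bidegreeLE_coeff F
  set M := F.natDegree with hM
  refine ⟨M, M * a + 1, hpos, Nat.succ_pos _, fun n => ?_⟩
  have hq1 : (1 : ℝ) ≤ q := by exact_mod_cast hq.le
  set x := max 1 (absL Fq q ξ) with hx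
  set y := max 1 (absL Fq q η) with hy
  set z := max 1 (absL Fq q (φ F.leadingCoeff)) with hz
  have hx1 : 1 ≤ x := le_max_left _ _
  have hy1 : 1 ≤ y := le_max_left _ _
  have hz1 : 1 ≤ z := le_max_left _ _
  have hc' : 1 ≤ x ^ (M * (n * a)) * z ^ n * y ^ M :=
    one_le_mul_of_one_le_of_one_le (one_le_mul_of_one_le_of_one_le (one_le_pow₀ hx1)
      (one_le_pow₀ hz1)) (one_le_pow₀ hy1)
  refine ⟨(q : ℝ) ^ (M * (n * l)) * (x ^ (M * (n * a)) * z ^ n * y ^ M),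
    one_le_mul_of_one_le_of_one_le (one_le_pow₀ hq1) hc', fun P hP hPη => ?_⟩
  have hP0 : P ≠ 0 := by rintro rfl; simp [evalP] at hPη
  have hPb : BidegreeLE n (innerDegree P) P := ⟨hP, natDegree_coeff_le_innerDegree P⟩
  have hPC : (P.map C).eval₂ φ η = evalP Fq η P := by
    rw [Polynomial.eval₂_map, evalP]
    congr 1
    ext <;> simp [φ]
  have hPCdeg : (P.map (C : Fq[X] →+* Fq[X][X])).natDegree ≤ n :=
    Polynomial.natDegree_map_le.trans hP
  have hent := BidegreeLE.companionEval hal hPb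
  have hdet := BidegreeLE.det hent
  rw [heightP_of_ne_zero hP0]
  have hsplit : (q : ℝ) ^ (M * (innerDegree P + n * l)) =
      (q : ℝ) ^ (M * (n * l)) * ((q : ℝ) ^ innerDegree P) ^ M := by
    rw [← pow_mul, ← pow_add]; congr 1; ring
  refine ⟨(companionEval F n (P.map C)).det, ?_, ?_, ?_, ?_⟩
  · refine hdet.1.trans ?_
    rw [add_mul]
    exact le_of_eq_of_le (by ring) (Nat.le_add_right _ _)
  · exact (map_ne_zero_iff φ hφ).2 (det_companionEval_ne_zero φ hφ η F hF0 hF hmin n _ hPCdeg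
      (by rwa [hPC]))
  · change absL Fq q (φ _) ≤ _
    have hAP := absL_nonneg (q := q) (evalP Fq η P)
    rw [map_det_companionEval φ η F hF hpos n _ hPCdeg, hPC]
    refine absL_sum_le hq (by positivity) fun j _ => ?_
    rw [absL_mul hq, absL_mul hq, absL_mul hq, absL_pow hq, absL_pow hq]
    have hadj : absL Fq q (φ ((companionEval F n (P.map C)).adjugate ⟨0, hpos⟩ j)) ≤ _ :=
      absL_evalP_le hq ξ (BidegreeLE.adjugate hent ⟨0, hpos⟩ j)
    have h1 := absL_nonneg (q := q) (φ F.leadingCoeff)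
    have h2 := absL_nonneg (q := q) η
    have hlead : absL Fq q (φ F.leadingCoeff) ≤ z := le_max_right _ _
    have hηy : absL Fq q η ^ (j : ℕ) ≤ y ^ M :=
      (pow_le_pow_left₀ h2 (le_max_right _ _) _).trans (pow_le_pow_right₀ hy1 j.2.le)
    calc _ ≤ ((q : ℝ) ^ (M * (innerDegree P + n * l)) * x ^ (M * (n * a))) *
          (z ^ n * absL Fq q (evalP Fq η P) * y ^ M) := by gcongr
      _ = _ := by rw [hsplit]; ring
  · refine (heightP_le hq hdet).trans ?_
    rw [hsplit]
    gcongr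
    exact le_mul_of_one_le_right (by positivity) hc'

lemma infinite_transfer [Finite Fq] (hq : 1 < q) {M N n : ℕ} (hM : 0 < M) {c : ℝ} (hc : 1 ≤ c)
    (htrans : ∀ P : Fq[X][X], P.natDegree ≤ n →
      evalP Fq η P ≠ 0 → ∃ D : Fq[X][X], D.natDegree ≤ N ∧ evalP Fq ξ D ≠ 0 ∧
        absL Fq q (evalP Fq ξ D) ≤ c * heightP Fq q P ^ M * absL Fq q (evalP Fq η P) ∧
        heightP Fq q D ≤ c * heightP Fq q P ^ M) {w : ℝ} (hw : (M : ℝ) + 1 ≤ w)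
    (hinf : {P : Fq[X][X] | P.natDegree ≤ n ∧ 0 < absL Fq q (evalP Fq η P) ∧
      absL Fq q (evalP Fq η P) ≤ heightP Fq q P ^ (-w)}.Infinite) :
    {P : Fq[X][X] | P.natDegree ≤ N ∧ 0 < absL Fq q (evalP Fq ξ P) ∧
      absL Fq q (evalP Fq ξ P) ≤ heightP Fq q P ^ (-((w - M - 1) / M))}.Infinite := by
  set w' := (w - M - 1) / M with hw'
  have hM' : (0 : ℝ) < M := by exact_mod_cast hM
  have hw'0 : 0 ≤ w' := div_nonneg (by linarith) hM'.le
  have hMw' : M * w' = w - M - 1 := by rw [hw']; field_simp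
  intro hfin
  obtain ⟨b, hb⟩ := (hfin.image fun D => (absL Fq q (evalP Fq ξ D))⁻¹).bddAbove
  obtain ⟨h, hh⟩ := pow_unbounded_of_one_lt (max (c * b) (c ^ (1 + w')))
    (by exact_mod_cast hq : (1 : ℝ) < q)
  obtain ⟨P, ⟨hPn, hPpos, hPle⟩, hPh⟩ := hinf.exists_notMem_finite (finite_bidegreeLE n h)
  have hPη : evalP Fq η P ≠ 0 := (absL_pos hq).1 hPpos
  have hP0 : P ≠ 0 := by rintro rfl; simp [evalP] at hPη
  have hdeg : h ≤ innerDegree P := by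
    by_contra hlt
    exact hPh ⟨hPn, fun i => (natDegree_coeff_le_innerDegree P i).trans (not_le.1 hlt).le⟩
  set H := heightP Fq q P with hH
  have hqH : (q : ℝ) ^ h ≤ H := by
    rw [hH, heightP_of_ne_zero hP0]
    exact pow_le_pow_right₀ (by exact_mod_cast hq.le) hdeg
  have hH1 : 1 ≤ H := one_le_heightP hq hP0
  have hH0 : 0 < H := by linarith
  have hc0 : 0 < c := by linarith
  obtain ⟨D, hDn, hDξ, hDle, hDH⟩ := htrans P hPn hPη
  have hD0 : D ≠ 0 := by rintro rfl; simp [evalP] at hDξ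
  have hDH1 : 1 ≤ heightP Fq q D := one_le_heightP hq hD0
  have hDpos : 0 < absL Fq q (evalP Fq ξ D) := (absL_pos hq).2 hDξ
  have hDle' : absL Fq q (evalP Fq ξ D) ≤ c * H ^ ((M : ℝ) - w) := by
    refine hDle.trans ?_
    rw [sub_eq_add_neg, Real.rpow_add hH0, Real.rpow_natCast, mul_assoc]
    gcongr
  have hmem : absL Fq q (evalP Fq ξ D) ≤ heightP Fq q D ^ (-w') := by
    have h1 : heightP Fq q D ^ w' ≤ c ^ w' * H ^ (w - M - 1) := by
      calc _ ≤ (c * H ^ M) ^ w' := Real.rpow_le_rpow (by linarith) hDH hw'0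
        _ = _ := by
          rw [Real.mul_rpow hc0.le (by positivity), ← Real.rpow_natCast, ← Real.rpow_mul hH0.le,
            hMw']
    have h2 : c ^ w' * c ≤ H := by
      have := (le_max_right _ _).trans (hh.le.trans hqH)
      rwa [add_comm, Real.rpow_add hc0, Real.rpow_one] at this
    rw [Real.rpow_neg (by linarith), ← one_div, le_div_iff₀ (Real.rpow_pos_of_pos (by linarith) _)]
    have h3 : H ^ ((M : ℝ) - w) * H ^ (w - M - 1) = H⁻¹ := by
      rw [← Real.rpow_add hH0, ← Real.rpow_neg_one]; congr 1; ring
    calc _ ≤ (c * H ^ ((M : ℝ) - w)) * (c ^ w' * H ^ (w - M - 1)) := by gcongr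
      _ = (c ^ w' * c) * (H ^ ((M : ℝ) - w) * H ^ (w - M - 1)) := by ring
      _ ≤ H * H⁻¹ := by rw [h3]; gcongr
      _ = 1 := mul_inv_cancel₀ hH0.ne'
  have hbD : (absL Fq q (evalP Fq ξ D))⁻¹ ≤ b := hb ⟨D, ⟨hDn, hDpos, hmem⟩, rfl⟩
  have hsmall : absL Fq q (evalP Fq ξ D) ≤ c * H⁻¹ := by
    refine hDle'.trans ?_
    rw [← Real.rpow_neg_one]
    gcongr
    linarith
  have hHlt : c * b < H := (le_max_left _ _).trans_lt (hh.trans_le hqH)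
  have hone : 1 ≤ b * absL Fq q (evalP Fq ξ D) := by
    rwa [inv_le_iff_one_le_mul₀ hDpos] at hbD
  have hb0 : 0 < b := (inv_pos.2 hDpos).trans_le hbD
  have : b * absL Fq q (evalP Fq ξ D) ≤ (c * b) * H⁻¹ := by
    calc _ ≤ b * (c * H⁻¹) := by gcongr
      _ = _ := by ring
  have hlt : (c * b) * H⁻¹ < 1 := by
    rw [← div_eq_mul_inv, div_lt_one hH0]; exact hHlt
  linarith

lemma exists_wn_transfer [Finite Fq] (hq : 1 < q) (hξ : ¬ IsAlgLS Fq ξ) (hdep : AlgDep Fq ξ η) :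
    ∃ M K : ℕ, 0 < M ∧ 0 < K ∧ ∀ (n : ℕ) (c : ℝ), (M : ℝ) + 1 ≤ c → (c : EReal) < wn Fq q n η →
      (((c - M - 1) / M : ℝ) : EReal) ≤ wn Fq q (K * n) ξ := by
  obtain ⟨M, K, hM, hK, htrans⟩ := exists_transfer hq hξ hdep
  refine ⟨M, K, hM, hK, fun n c hc hlt => ?_⟩
  obtain ⟨d, hd, hdtrans⟩ := htrans n
  obtain ⟨_, ⟨w, hw, rfl⟩, hcw⟩ := lt_sSup_iff.1 hlt
  have hcw' : c < w := EReal.coe_lt_coe_iff.1 hcw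
  have hinf := infinite_transfer hq hM hd hdtrans (by linarith) hw
  refine le_trans (EReal.coe_le_coe_iff.2 ?_) (le_sSup ⟨_, hinf, rfl⟩)
  gcongr

lemma exists_wn_eq_top_of_algDep [Finite Fq] (hq : 1 < q) (hξ : ¬ IsAlgLS Fq ξ)
    (hdep : AlgDep Fq ξ η) (htop : ∃ n : ℕ, 1 ≤ n ∧ wn Fq q n η = ⊤) :
    ∃ n : ℕ, 1 ≤ n ∧ wn Fq q n ξ = ⊤ := by
  obtain ⟨M, K, hM, hK, htrans⟩ := exists_wn_transfer hq hξ hdep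
  obtain ⟨n, hn, htop⟩ := htop
  refine ⟨K * n, Nat.mul_pos hK hn, ?_⟩
  rw [EReal.eq_top_iff_forall_lt]
  intro y
  have hM' : (0 : ℝ) < M := by exact_mod_cast hM
  have hyabs := le_abs_self y
  have hy0 := abs_nonneg y
  refine lt_of_lt_of_le ?_ (htrans n (M * (|y| + 1) + M + 1) (by nlinarith)
    (by rw [htop]; exact EReal.coe_lt_top _))
  rw [EReal.coe_lt_coe_iff, lt_div_iff₀ hM']
  nlinarith

lemma exists_wB_transfer [Finite Fq] (hq : 1 < q) (hξ : ¬ IsAlgLS Fq ξ) (hdep : AlgDep Fq ξ η) :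
    ∃ t : ℝ, 0 < t ∧ ∀ c : ℝ, 0 < c → (c : EReal) < wB Fq q η →
      ((c * t : ℝ) : EReal) ≤ wB Fq q ξ := by
  obtain ⟨M, K, hM, hK, htrans⟩ := exists_wn_transfer hq hξ hdep
  have hM' : (0 : ℝ) < M := by exact_mod_cast hM
  have hK' : (0 : ℝ) < K := by exact_mod_cast hK
  refine ⟨(2 * M * K)⁻¹, by positivity, fun c hc hlt => ?_⟩
  have hfreq := Filter.frequently_lt_of_lt_limsup (by isBoundedDefault) hlt
  obtain ⟨n₀, hn₀⟩ := exists_nat_gt ((2 * M + 2) / c)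
  refine Filter.le_limsup_of_frequently_le' ?_
  refine (Filter.tendsto_id.const_mul_atTop' hK).frequently ?_
  refine (hfreq.and_eventually (Filter.eventually_ge_atTop (max n₀ 1))).mono ?_
  rintro n ⟨hn, hnge⟩
  have hn1 : 0 < n := lt_of_lt_of_le one_pos ((le_max_right _ _).trans hnge)
  have hn1' : (0 : ℝ) < n := by exact_mod_cast hn1
  have hnn₀ : (n₀ : ℝ) ≤ n := by exact_mod_cast (le_max_left _ _).trans hnge
  have hlarge : 2 * M + 2 < c * n := by
    rw [div_lt_iff₀ hc] at hn₀
    nlinarith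
  have hcast : ∀ k : ℕ, (k : EReal) = ((k : ℝ) : EReal) := fun k => rfl
  rw [hcast, EReal.lt_div_iff (by exact_mod_cast hn1') (EReal.coe_ne_top _),
    ← EReal.coe_mul] at hn
  have hres := htrans n (c * n) (by linarith) hn
  rw [id, hcast, EReal.le_div_iff_mul_le (by push_cast; positivity) (EReal.coe_ne_top _),
    ← EReal.coe_mul]
  refine le_trans (EReal.coe_le_coe_iff.2 ?_) hres
  rw [le_div_iff₀ hM']
  push_cast
  field_simp
  linarith

lemma wB_pos_of_algDep [Finite Fq] (hq : 1 < q) (hξ : ¬ IsAlgLS Fq ξ) (hdep : AlgDep Fq ξ η)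
    (hpos : 0 < wB Fq q η) : 0 < wB Fq q ξ := by
  obtain ⟨t, ht, htrans⟩ := exists_wB_transfer hq hξ hdep
  obtain ⟨c, hc0, hc⟩ := EReal.lt_iff_exists_real_btwn.1 hpos
  have hc0' : 0 < c := by exact_mod_cast hc0
  refine lt_of_lt_of_le ?_ (htrans c hc0' hc)
  exact_mod_cast mul_pos hc0' ht

lemma wB_eq_top_of_algDep [Finite Fq] (hq : 1 < q) (hξ : ¬ IsAlgLS Fq ξ) (hdep : AlgDep Fq ξ η)
    (htop : wB Fq q η = ⊤) : wB Fq q ξ = ⊤ := by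
  obtain ⟨t, ht, htrans⟩ := exists_wB_transfer hq hξ hdep
  rw [EReal.eq_top_iff_forall_lt]
  intro y
  have hy := le_abs_self y
  refine lt_of_lt_of_le ?_ (htrans ((|y| + 1) / t) (by positivity)
    (by rw [htop]; exact EReal.coe_lt_top _))
  rw [EReal.coe_lt_coe_iff, div_mul_cancel₀ _ ht.ne']
  linarith

end Transfer

end OotoT


/-- Two algebraically dependent transcendental Laurent series lie in the
same Mahler class. -/
theorem algDep_same_class (p : ℕ) (hp : p.Prime) (q : ℕ) (hq : ∃ e : ℕ, 0 < e ∧ q = p ^ e)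
    (Fq : Type) [Field Fq] [Fintype Fq] [CharP Fq p] (hcard : Fintype.card Fq = q)
    (ξ η : LaurentSeries Fq) (hξ : ¬ IsAlgLS Fq ξ) (hη : ¬ IsAlgLS Fq η)
    (hdep : AlgDep Fq ξ η) :
    (IsSNumber Fq q ξ ↔ IsSNumber Fq q η) ∧ (IsTNumber Fq q ξ ↔ IsTNumber Fq q η) ∧
      (IsUNumber Fq q ξ ↔ IsUNumber Fq q η) := by
  obtain ⟨e, he, rfl⟩ := hq
  have hq1 : 1 < p ^ e := Nat.one_lt_pow he.ne' hp.one_lt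
  have hdep' := hdep.symm
  have hpos : 0 < wB Fq (p ^ e) ξ ↔ 0 < wB Fq (p ^ e) η :=
    ⟨wB_pos_of_algDep hq1 hη hdep', wB_pos_of_algDep hq1 hξ hdep⟩
  have htop : wB Fq (p ^ e) ξ = ⊤ ↔ wB Fq (p ^ e) η = ⊤ :=
    ⟨wB_eq_top_of_algDep hq1 hη hdep', wB_eq_top_of_algDep hq1 hξ hdep⟩
  have hwn : (∃ n : ℕ, 1 ≤ n ∧ wn Fq (p ^ e) n ξ = ⊤) ↔ ∃ n : ℕ, 1 ≤ n ∧ wn Fq (p ^ e) n η = ⊤ :=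
    ⟨exists_wn_eq_top_of_algDep hq1 hη hdep', exists_wn_eq_top_of_algDep hq1 hξ hdep⟩
  have hfin : ∀ ζ : LaurentSeries Fq, (∀ n : ℕ, 1 ≤ n → wn Fq (p ^ e) n ζ < ⊤) ↔
      ¬ ∃ n : ℕ, 1 ≤ n ∧ wn Fq (p ^ e) n ζ = ⊤ := by
    intro ζ
    simp only [lt_top_iff_ne_top, not_exists, not_and, ne_eq]
  refine ⟨?_, ?_, ?_⟩
  · simp only [IsSNumber, lt_top_iff_ne_top, ne_eq, hpos, htop]
  · simp only [IsTNumber, hfin, htop, hwn]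
  · simp only [IsUNumber, htop, hwn]
end
end
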